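/- Assume in addition that (C1) limsup_{t↓0} t^{−1}(F(t) − F(0)) < ∞ and (C2) ∫₀^∞ t³ dF(t) < ∞. Define the diffusion-scaled superposition B̃ₙ(t) = (n γₙ)^{−1/2} (Bₙ(γₙ t) − n μ γₙ t). Then there exists a constant c ∈ (0, ∞) such that for all 0 ≤ r ≤ s ≤ t and all n ∈ ℕ, E[ (B̃ₙ(s) − B̃ₙ(r))² (B̃ₙ(t) − B̃ₙ(s))² ] ≤ c (t − r)². -/

import Mathlib

open MeasureTheory ProbabilityTheory Set Filter

set_option linter.unusedSectionVars false
set_option linter.unusedVariables false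

namespace RenAux
open scoped ENNReal NNReal

lemma indep_dep {Ω ι α β : Type*} [MeasurableSpace Ω] [MeasurableSpace α] [MeasurableSpace β]
    {P : Measure Ω} {ξ : ι → Ω → ℝ} (hi : iIndepFun ξ P) (hm : ∀ i, Measurable (ξ i))
    {S T : Set ι} (hST : Disjoint S T) {f : (ι → ℝ) → α} {g : (ι → ℝ) → β}
    (hf : Measurable f) (hg : Measurable g)
    (hfS : ∀ x y : ι → ℝ, (∀ i ∈ S, x i = y i) → f x = f y)
    (hgT : ∀ x y : ι → ℝ, (∀ i ∈ T, x i = y i) → g x = g y) :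
    IndepFun (fun ω => f (fun i => ξ i ω)) (fun ω => g (fun i => ξ i ω)) P := by
  classical
  have h1 : Indep (⨆ i ∈ S, MeasurableSpace.comap (ξ i) inferInstance)
      (⨆ i ∈ T, MeasurableSpace.comap (ξ i) inferInstance) P :=
    indep_iSup_of_disjoint (fun i => (hm i).comap_le) hi hST
  have key : ∀ (A : Set ι), @Measurable _ _ (⨆ i ∈ A, MeasurableSpace.comap (ξ i) inferInstance) _
      (fun ω (i : ι) => if i ∈ A then ξ i ω else 0) := by
    intro A
    refine @measurable_pi_lambda _ _ _ (⨆ i ∈ A, MeasurableSpace.comap (ξ i) inferInstance) _ _ ?_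
    intro i
    by_cases h : i ∈ A
    · simp only [h, if_true]
      refine Measurable.mono (comap_measurable (ξ i)) ?_ le_rfl
      exact le_iSup₂ (f := fun i (_ : i ∈ A) => MeasurableSpace.comap (ξ i) inferInstance) i h
    · simp only [h, if_false]
      exact measurable_const
  have e1 : (fun ω => f (fun i => ξ i ω)) = fun ω => f (fun i => if i ∈ S then ξ i ω else 0) := by
    ext ω; exact hfS _ _ (fun i hi => by simp [hi])
  have e2 : (fun ω => g (fun i => ξ i ω)) = fun ω => g (fun i => if i ∈ T then ξ i ω else 0) := by
    ext ω; exact hgT _ _ (fun i hi => by simp [hi])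
  rw [e1, e2]
  refine indep_of_indep_of_le_left (indep_of_indep_of_le_right h1 ?_) ?_
  · exact Measurable.comap_le (hg.comp (key T))
  · exact Measurable.comap_le (hf.comp (key S))

def ps (x : ℕ → ℝ) (k : ℕ) : ℝ := ∑ i ∈ Finset.range k, x i

lemma measurable_ps (k : ℕ) : Measurable (fun x : ℕ → ℝ => ps x k) := by
  unfold ps; fun_prop

lemma ps_succ (x : ℕ → ℝ) (k : ℕ) : ps x (k+1) = ps x k + x k := Finset.sum_range_succ _ _

structure Ren {Ω : Type*} [MeasurableSpace Ω] (P : Measure Ω) (ν : Measure ℝ) (μ : ℝ)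
    (η : ℕ → Ω → ℝ) : Prop where
  meas : ∀ k, Measurable (η k)
  nonneg : ∀ k ω, 0 ≤ η k ω
  indep : iIndepFun η P
  law0 : Measure.map (η 0) P = volume.withDensity
    (fun t => ENNReal.ofReal μ * (Ici (0:ℝ)).indicator (fun u => ν (Ioi u)) t)
  law : ∀ k, Measure.map (η (k+1)) P = ν
  μpos : 0 < μ
  supp : ∀ᵐ x ∂ν, 0 ≤ x
  mean : ∫ x, x ∂ν = 1 / μ
  int3 : Integrable (fun x => x ^ 3) ν

section
variable {Ω : Type*} [MeasurableSpace Ω] {P : Measure Ω} [IsProbabilityMeasure P]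
  {ν : Measure ℝ} [IsProbabilityMeasure ν] {μ : ℝ} {η : ℕ → Ω → ℝ}

lemma Ren.ps_mono (h : Ren P ν μ η) (ω : Ω) : Monotone (ps (fun i => η i ω)) := by
  refine monotone_nat_of_le_succ (fun n => ?_)
  rw [ps_succ]; linarith [h.nonneg n ω]

lemma Ren.meas_ps (h : Ren P ν μ η) (k : ℕ) : Measurable (fun ω => ps (fun i => η i ω) k) := by
  have := h.meas
  unfold ps; fun_prop

lemma Ren.lint (h : Ren P ν μ η) (k : ℕ) {f : ℝ → ℝ≥0∞} (hf : Measurable f) :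
    ∫⁻ ω, f (η (k+1) ω) ∂P = ∫⁻ x, f x ∂ν := by
  rw [← h.law k, lintegral_map hf (h.meas _)]

lemma Ren.integral (h : Ren P ν μ η) (k : ℕ) {f : ℝ → ℝ} (hf : Measurable f) :
    ∫ ω, f (η (k+1) ω) ∂P = ∫ x, f x ∂ν := by
  rw [← h.law k, integral_map (h.meas _).aemeasurable hf.aestronglyMeasurable]

noncomputable def rho (ν : Measure ℝ) : ℝ := ∫ x, Real.exp (-x) ∂ν

lemma int_exp (hs : ∀ᵐ x ∂ν, 0 ≤ x) : Integrable (fun x => Real.exp (-x)) ν := by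
  refine Integrable.of_bound (by fun_prop) 1 ?_
  filter_upwards [hs] with x hx
  rw [Real.norm_eq_abs, abs_of_pos (Real.exp_pos _)]
  simpa using hx

lemma rho_nonneg (ν : Measure ℝ) : 0 ≤ rho ν := integral_nonneg (fun x => (Real.exp_pos _).le)

lemma Ren.rho_lt (h : Ren P ν μ η) : rho ν < 1 := by
  have hI := int_exp h.supp
  have h1 : 0 ≤ᵐ[ν] fun x => 1 - Real.exp (-x) := by
    filter_upwards [h.supp] with x hx
    simpa using hx
  have hint : Integrable (fun x => 1 - Real.exp (-x)) ν := (integrable_const _).sub hI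
  have h2 : ∫ x, (1 - Real.exp (-x)) ∂ν = 1 - rho ν := by
    rw [integral_sub (integrable_const _) hI]; simp [rho]
  by_contra hcon
  have h3 : ∫ x, (1 - Real.exp (-x)) ∂ν = 0 :=
    le_antisymm (by rw [h2]; linarith) (integral_nonneg_of_ae h1)
  rw [integral_eq_zero_iff_of_nonneg_ae h1 hint] at h3
  have h4 : (fun x : ℝ => x) =ᵐ[ν] 0 := by
    filter_upwards [h3] with x hx
    have : Real.exp (-x) = 1 := by
      have hx' : 1 - Real.exp (-x) = 0 := hx
      linarith
    simpa using this
  have h5 := integral_congr_ae h4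
  rw [h.mean] at h5
  have := h.μpos
  simp at h5
  linarith

lemma Ren.tail (h : Ren P ν μ η) (A : Finset ℕ) (hA : 0 ∉ A) (u : ℝ) :
    P {ω | ∑ i ∈ A, η i ω ≤ u} ≤ ENNReal.ofReal (Real.exp u * rho ν ^ A.card) := by
  have hmg : mgf (∑ i ∈ A, η i) P (-1) = rho ν ^ A.card := by
    rw [h.indep.mgf_sum h.meas]
    rw [Finset.prod_congr rfl (g := fun _ => rho ν)]
    · simp
    · intro i hi
      obtain ⟨j, rfl⟩ : ∃ j, i = j + 1 := Nat.exists_eq_succ_of_ne_zero (by rintro rfl; exact hA hi)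
      unfold mgf
      rw [h.integral j (f := fun x => Real.exp (-1 * x)) (by fun_prop)]
      simp [rho]
  have hint : Integrable (fun ω => Real.exp (-1 * (∑ i ∈ A, η i) ω)) P := by
    have hm : Measurable (∑ i ∈ A, η i) := by
      have := Finset.measurable_sum A (fun i _ => h.meas i)
      convert this using 1
      ext ω; simp
    refine Integrable.of_bound (by fun_prop) 1 (Eventually.of_forall fun ω => ?_)
    rw [Real.norm_eq_abs, abs_of_pos (Real.exp_pos _)]
    have : 0 ≤ ∑ i ∈ A, η i ω := Finset.sum_nonneg (fun i _ => h.nonneg i ω)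
    simpa using this
  have := measure_le_le_exp_mul_mgf (μ := P) (X := ∑ i ∈ A, η i) u (by norm_num : (-1:ℝ) ≤ 0) hint
  rw [hmg] at this
  simp only [Finset.sum_apply, neg_neg, one_mul] at this
  rw [← ENNReal.ofReal_toReal (measure_ne_top P _)]
  exact ENNReal.ofReal_le_ofReal this

lemma Ren.tail_tendsto (h : Ren P ν μ η) (u : ℝ) :
    Tendsto (fun n : ℕ => ENNReal.ofReal (Real.exp u * rho ν ^ n)) atTop (nhds 0) := by
  have := (tendsto_pow_atTop_nhds_zero_of_lt_one (rho_nonneg ν) h.rho_lt).const_mul (Real.exp u)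
  rw [mul_zero] at this
  simpa using ENNReal.tendsto_ofReal this

/-- ordinary partial sums diverge -/
lemma Ren.diverge (h : Ren P ν μ η) :
    ∀ᵐ ω ∂P, ∀ s : ℝ, ∃ m, s < ps (fun i => η (i+1) ω) m := by
  have h1 : ∀ s : ℕ, ∀ᵐ ω ∂P, ∃ m, (s:ℝ) < ps (fun i => η (i+1) ω) m := by
    intro s
    rw [ae_iff]
    push Not
    refine le_antisymm ?_ zero_le
    refine ge_of_tendsto' (h.tail_tendsto s) (fun n => ?_)
    have := h.tail ((Finset.range n).map ⟨(· + 1), add_left_injective 1⟩) (by simp) s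
    simp only [Finset.card_map, Finset.card_range, Finset.sum_map, Function.Embedding.coeFn_mk] at this
    refine le_trans (measure_mono ?_) this
    intro ω hω
    exact hω n
  rw [← ae_all_iff] at h1
  filter_upwards [h1] with ω hω s
  obtain ⟨n, hn⟩ := exists_nat_gt s
  obtain ⟨m, hm⟩ := hω n
  exact ⟨m, hn.trans hm⟩

lemma Ren.diverge' (h : Ren P ν μ η) :
    ∀ᵐ ω ∂P, ∀ s : ℝ, ∃ m, s < ps (fun i => η i ω) (m+1) := by
  filter_upwards [h.diverge] with ω hω s
  obtain ⟨m, hm⟩ := hω s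
  refine ⟨m, hm.trans_le ?_⟩
  unfold ps
  rw [Finset.sum_range_succ']
  linarith [h.nonneg 0 ω]

end
end RenAux

namespace RenAux
open scoped ENNReal NNReal
section
variable {Ω : Type*} [MeasurableSpace Ω] {P : Measure Ω} [IsProbabilityMeasure P]
  {ν : Measure ℝ} [IsProbabilityMeasure ν] {μ : ℝ} {η : ℕ → Ω → ℝ}

lemma lint_indep {X Y : Ω → ℝ} (hX : Measurable X) (hY : Measurable Y) (hXY : IndepFun X Y P)
    {g : ℝ → ℝ → ℝ≥0∞} (hg : Measurable (Function.uncurry g)) :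
    ∫⁻ ω, g (X ω) (Y ω) ∂P = ∫⁻ ω, ∫⁻ y, g (X ω) y ∂(Measure.map Y P) ∂P := by
  have : IsProbabilityMeasure (Measure.map Y P) := Measure.isProbabilityMeasure_map hY.aemeasurable
  have h1 := (indepFun_iff_map_prod_eq_prod_map_map hX.aemeasurable hY.aemeasurable).1 hXY
  have h2 : ∫⁻ ω, g (X ω) (Y ω) ∂P
      = ∫⁻ z, Function.uncurry g z ∂(Measure.map (fun ω => (X ω, Y ω)) P) := by
    rw [lintegral_map hg (hX.prodMk hY)]; rfl
  rw [h2, h1, lintegral_prod _ hg.aemeasurable, lintegral_map _ hX]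
  · rfl
  · exact hg.lintegral_prod_right'

lemma Ren.indep_ps (h : Ren P ν μ η) (k : ℕ) :
    IndepFun (fun ω => ps (fun i => η i ω) k) (η k) P := by
  refine indep_dep (S := {i | i < k}) (T := {k}) h.indep h.meas ?_ (f := fun x => ps x k)
    (g := fun x => x k) (measurable_ps k) (measurable_pi_apply k) ?_ ?_
  · simp
  · intro x y hxy
    exact Finset.sum_congr rfl (fun i hi => hxy i (by simpa using hi))
  · intro x y hxy
    exact hxy k rfl

lemma Ren.indep_ops (h : Ren P ν μ η) (k : ℕ) :
    IndepFun (fun ω => ps (fun i => η (i+1) ω) k) (η (k+1)) P := by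
  refine indep_dep (S := {i | i < k+1}) (T := {k+1}) h.indep h.meas ?_
    (f := fun x => ps (fun i => x (i+1)) k)
    (g := fun x => x (k+1)) (by unfold ps; fun_prop) (measurable_pi_apply (k+1)) ?_ ?_
  · simp
  · intro x y hxy
    exact Finset.sum_congr rfl (fun i hi => hxy _ (by simpa using hi))
  · intro x y hxy
    exact hxy _ rfl

lemma Ren.indep_ops0 (h : Ren P ν μ η) (k : ℕ) :
    IndepFun (fun ω => ps (fun i => η (i+1) ω) k) (η 0) P := by
  refine indep_dep (S := {i | 0 < i}) (T := {0}) h.indep h.meas ?_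
    (f := fun x => ps (fun i => x (i+1)) k)
    (g := fun x => x 0) (by unfold ps; fun_prop) (measurable_pi_apply 0) ?_ ?_
  · simp
  · intro x y hxy
    exact Finset.sum_congr rfl (fun i hi => hxy _ (by simp))
  · intro x y hxy
    exact hxy _ rfl

lemma Ren.meas_ops (h : Ren P ν μ η) (k : ℕ) : Measurable (fun ω => ps (fun i => η (i+1) ω) k) := by
  have := h.meas
  unfold ps; fun_prop

lemma measurable_nuIoi : Measurable (fun u : ℝ => ν (Ioi u)) := by
  refine Antitone.measurable (fun a b hab => measure_mono (Ioi_subset_Ioi hab))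

lemma Ren.palm_term (h : Ren P ν μ η) {f : ℝ → ℝ≥0∞} (hf : Measurable f) (k : ℕ) :
    ∫⁻ ω, f (ps (fun i => η i ω) (k+1)) ∂P = ENNReal.ofReal μ *
      ∫⁻ u, f u * ∫⁻ ω, ({ω | ps (fun i => η (i+1) ω) k ≤ u ∧
        u < ps (fun i => η (i+1) ω) (k+1)}).indicator 1 ω ∂P := by
  have hO := h.meas_ops k
  have e1 : ∀ ω, ps (fun i => η i ω) (k+1) = ps (fun i => η (i+1) ω) k + η 0 ω := by
    intro ω; exact Finset.sum_range_succ' _ _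
  simp_rw [e1]
  rw [lint_indep hO (h.meas 0) (h.indep_ops0 k) (g := fun o x => f (o + x)) (by
    simp only [Function.uncurry_def]; fun_prop)]
  rw [h.law0]
  have hν := measurable_nuIoi (ν := ν)
  have hd : Measurable (fun t => ENNReal.ofReal μ * (Ici (0:ℝ)).indicator (fun u => ν (Ioi u)) t) :=
    (hν.indicator measurableSet_Ici).const_mul _
  have e2 : ∀ o : ℝ, ∫⁻ x, f (o + x) ∂(volume.withDensity
      (fun t => ENNReal.ofReal μ * (Ici (0:ℝ)).indicator (fun u => ν (Ioi u)) t))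
      = ENNReal.ofReal μ * ∫⁻ u, f u * ∫⁻ y, ({p : ℝ × ℝ | p.1 ≤ u ∧ u < p.1 + p.2}).indicator 1 (o, y) ∂ν := by
    intro o
    rw [lintegral_withDensity_eq_lintegral_mul _ hd (by fun_prop)]
    have : (fun u => f u * ∫⁻ y, ({p : ℝ × ℝ | p.1 ≤ u ∧ u < p.1 + p.2}).indicator 1 (o, y) ∂ν)
      = fun u => f u * (Ici (0:ℝ)).indicator (fun u => ν (Ioi u)) (u - o) := by
      ext u
      congr 1
      by_cases hu : o ≤ u
      · rw [indicator_of_mem (by simpa using hu)]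
        rw [← lintegral_indicator_one measurableSet_Ioi]
        refine lintegral_congr (fun y => ?_)
        by_cases hy : u < o + y
        · rw [indicator_of_mem (by exact ⟨hu, hy⟩), indicator_of_mem (by simp; linarith)]; rfl
        · rw [indicator_of_notMem (by simp; intro _; linarith), indicator_of_notMem (by simp; linarith)]
      · rw [indicator_of_notMem (by simpa using hu)]
        rw [← lintegral_zero]
        refine lintegral_congr (fun y => ?_)
        rw [indicator_of_notMem (by simp; intro h; exact absurd h hu)]
        
    rw [this]
    rw [← lintegral_add_left_eq_self (fun u => f u * (Ici (0:ℝ)).indicator (fun u => ν (Ioi u)) (u - o)) o]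
    rw [← lintegral_const_mul _ (by
      have := hν.indicator (measurableSet_Ici (a := (0:ℝ)))
      fun_prop)]
    refine lintegral_congr (fun x => ?_)
    simp only [Pi.mul_apply, add_sub_cancel_left]
    ring
  simp_rw [e2]
  have hms : MeasurableSet {q : ℝ × ℝ × ℝ | q.1 ≤ q.2.2 ∧ q.2.2 < q.1 + q.2.1} := by
    exact (measurableSet_le (f := fun q : ℝ × ℝ × ℝ => q.1) (g := fun q => q.2.2)
      (by fun_prop) (by fun_prop)).inter
      (measurableSet_lt (f := fun q : ℝ × ℝ × ℝ => q.2.2) (g := fun q => q.1 + q.2.1)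
      (by fun_prop) (by fun_prop))
  have hmi : Measurable (fun q : ℝ × ℝ × ℝ =>
      ({q : ℝ × ℝ × ℝ | q.1 ≤ q.2.2 ∧ q.2.2 < q.1 + q.2.1}).indicator (1 : ℝ × ℝ × ℝ → ℝ≥0∞) q) :=
    measurable_one.indicator hms
  have e4 : ∀ o y u : ℝ, ({p : ℝ × ℝ | p.1 ≤ u ∧ u < p.1 + p.2}).indicator (1 : ℝ × ℝ → ℝ≥0∞) (o, y)
      = ({q : ℝ × ℝ × ℝ | q.1 ≤ q.2.2 ∧ q.2.2 < q.1 + q.2.1}).indicator (1 : ℝ × ℝ × ℝ → ℝ≥0∞) (o, y, u) := by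
    intro o y u; simp [indicator]
  have hG : Measurable (fun q : ℝ × ℝ => f q.2 * ∫⁻ y, ({p : ℝ × ℝ | p.1 ≤ q.2 ∧ q.2 < p.1 + p.2}).indicator 1 (q.1, y) ∂ν) := by
    simp_rw [e4]
    refine Measurable.mul (by fun_prop) ?_
    refine Measurable.lintegral_prod_right' (f := fun q : (ℝ × ℝ) × ℝ =>
      ({q : ℝ × ℝ × ℝ | q.1 ≤ q.2.2 ∧ q.2.2 < q.1 + q.2.1}).indicator (1 : ℝ × ℝ × ℝ → ℝ≥0∞)
        (q.1.1, q.2, q.1.2)) ?_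
    exact hmi.comp (by fun_prop)
  rw [lintegral_const_mul _ (by
    have : Measurable (fun o : ℝ => ∫⁻ u, f u * ∫⁻ y, ({p : ℝ × ℝ | p.1 ≤ u ∧ u < p.1 + p.2}).indicator 1 (o, y) ∂ν) :=
      hG.lintegral_prod_right'
    exact this.comp hO)]
  congr 1
  rw [lintegral_lintegral_swap]
  · refine lintegral_congr (fun u => ?_)
    rw [lintegral_const_mul _ (by
      have : Measurable (fun o : ℝ => ∫⁻ y, ({p : ℝ × ℝ | p.1 ≤ u ∧ u < p.1 + p.2}).indicator 1 (o, y) ∂ν) := by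
        simp_rw [e4]
        refine Measurable.lintegral_prod_right' (f := fun q : ℝ × ℝ =>
          ({q : ℝ × ℝ × ℝ | q.1 ≤ q.2.2 ∧ q.2.2 < q.1 + q.2.1}).indicator (1 : ℝ × ℝ × ℝ → ℝ≥0∞)
            (q.1, q.2, u)) ?_
        exact hmi.comp (by fun_prop)
      exact this.comp hO)]
    congr 1
    have := lint_indep hO (h.meas (k+1)) (h.indep_ops k)
      (g := fun o y => ({p : ℝ × ℝ | p.1 ≤ u ∧ u < p.1 + p.2}).indicator 1 (o, y)) (by
        simp only [Function.uncurry_def]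
        simp_rw [e4]
        exact hmi.comp (by fun_prop))
    rw [h.law k] at this
    rw [← this]
    refine lintegral_congr (fun ω => ?_)
    simp [indicator, ps_succ]
  · exact (hG.comp (((hO.comp measurable_fst).prodMk measurable_snd :
      Measurable (fun q : Ω × ℝ => (ps (fun i => η (i+1) q.1) k, q.2))))).aemeasurable

lemma Ren.palm (h : Ren P ν μ η) {f : ℝ → ℝ≥0∞} (hf : Measurable f) :
    ∑' k, ∫⁻ ω, f (ps (fun i => η i ω) (k+1)) ∂P
      = ENNReal.ofReal μ * ∫⁻ u in Ici (0:ℝ), f u := by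
  simp_rw [h.palm_term hf]
  rw [ENNReal.tsum_mul_left]
  congr 1
  have hms : ∀ k, MeasurableSet {q : ℝ × Ω | ps (fun i => η (i+1) q.2) k ≤ q.1 ∧
        q.1 < ps (fun i => η (i+1) q.2) (k+1)} := by
    intro k
    have h1 := h.meas_ops k
    have h2 := h.meas_ops (k+1)
    refine MeasurableSet.inter ?_ ?_
    · exact measurableSet_le (h1.comp measurable_snd) (by fun_prop)
    · exact measurableSet_lt (by fun_prop) (h2.comp measurable_snd)
  have hms' : ∀ k u, MeasurableSet {ω : Ω | ps (fun i => η (i+1) ω) k ≤ u ∧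
        u < ps (fun i => η (i+1) ω) (k+1)} := by
    intro k u
    exact (hms k).preimage (by fun_prop : Measurable fun ω : Ω => (u, ω))
  rw [← lintegral_tsum]
  · rw [← lintegral_indicator measurableSet_Ici]
    refine lintegral_congr (fun u => ?_)
    rw [ENNReal.tsum_mul_left, ← lintegral_tsum]
    · have : ∀ᵐ ω ∂P, ∑' k, ({ω | ps (fun i => η (i+1) ω) k ≤ u ∧
        u < ps (fun i => η (i+1) ω) (k+1)}).indicator (1 : Ω → ℝ≥0∞) ω = (Ici (0:ℝ)).indicator 1 u := by
        filter_upwards [h.diverge] with ω hω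
        have hmono : Monotone (ps (fun i => η (i+1) ω)) := by
          refine monotone_nat_of_le_succ (fun n => ?_)
          rw [ps_succ]; linarith [h.nonneg (n+1) ω]
        have h0 : ps (fun i => η (i+1) ω) 0 = 0 := by simp [ps]
        by_cases hu : 0 ≤ u
        · rw [indicator_of_mem (by simpa using hu)]
          classical
          have hf := Nat.find_spec (hω u)
          obtain ⟨m, hm⟩ : ∃ m, Nat.find (hω u) = m + 1 := by
            refine Nat.exists_eq_succ_of_ne_zero (fun h00 => ?_)
            rw [h00, h0] at hf; linarith
          have hlt : ps (fun i => η (i+1) ω) m ≤ u := by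
            have := Nat.find_min (hω u) (m := m) (by omega)
            exact not_lt.1 this
          rw [hm] at hf
          rw [tsum_eq_single m]
          · rw [indicator_of_mem (by exact ⟨hlt, hf⟩)]; rfl
          · intro k hk
            apply indicator_of_notMem
            rintro ⟨ha, hb⟩
            rcases lt_or_gt_of_ne hk with hk | hk
            · have := hmono (show k + 1 ≤ m by omega)
              linarith
            · have := hmono (show m + 1 ≤ k by omega)
              linarith
        · rw [indicator_of_notMem (by simpa using hu)]
          rw [ENNReal.tsum_eq_zero]
          intro k
          apply indicator_of_notMem
          rintro ⟨ha, hb⟩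
          have := hmono (Nat.zero_le k)
          linarith
      rw [lintegral_congr_ae this]
      by_cases hu : 0 ≤ u <;> simp [hu]
    · intro k
      exact (measurable_one.indicator (hms' k u)).aemeasurable
  · intro k
    refine (hf.mul ?_).aemeasurable
    have hone : Measurable (1 : ℝ × Ω → ℝ≥0∞) := measurable_one
    exact (hone.indicator (hms k)).lintegral_prod_right'

/-- expected number of points in `(r,s]` -/
lemma Ren.palm_Ioc (h : Ren P ν μ η) {r s : ℝ} (hr : 0 ≤ r) :
    ∑' k, P {ω | ps (fun i => η i ω) (k+1) ∈ Ioc r s} = ENNReal.ofReal (μ * (s - r)) := by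
  have hsub : Ioc r s ∩ Ici 0 = Ioc r s := inter_eq_left.2 (fun x hx => hr.trans hx.1.le)
  have := h.palm (f := (Ioc r s).indicator 1) (measurable_one.indicator measurableSet_Ioc)
  rw [lintegral_indicator_one measurableSet_Ioc, Measure.restrict_apply measurableSet_Ioc,
    hsub, Real.volume_Ioc,
    ← ENNReal.ofReal_mul h.μpos.le] at this
  rw [← this]
  congr 1; ext k
  exact (lintegral_indicator_one ((h.meas_ps (k+1)) measurableSet_Ioc)).symm

end
end RenAux

namespace RenAux
open scoped ENNReal NNReal

noncomputable def cnt (x : ℕ → ℝ) (r s : ℝ) : ℝ≥0∞ := ∑' k, (Ioc r s).indicator 1 (ps x (k+1))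

lemma measurable_cnt (r s : ℝ) : Measurable (fun x => cnt x r s) := by
  unfold cnt
  refine Measurable.tsum (fun k => ?_)
  exact (measurable_one.indicator measurableSet_Ioc).comp (measurable_ps (k+1))

lemma cnt_finset {x : ℕ → ℝ} (hx : Monotone (ps x)) (hd : ∀ s : ℝ, ∃ m, s < ps x (m+1)) (r s : ℝ) :
    ∃ J : Finset ℕ, (∀ k, k ∈ J ↔ ps x (k+1) ∈ Ioc r s) ∧ cnt x r s = J.card := by
  classical
  obtain ⟨m, hm⟩ := hd s
  have hlt : ∀ k, ps x (k+1) ∈ Ioc r s → k < m := by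
    intro k hk
    by_contra hcon
    have := hx (show m + 1 ≤ k + 1 by omega)
    linarith [hk.2]
  refine ⟨(Finset.range m).filter (fun k => ps x (k+1) ∈ Ioc r s), ?_, ?_⟩
  · intro k
    simp only [Finset.mem_filter, Finset.mem_range, and_iff_right_iff_imp]
    exact hlt k
  · unfold cnt
    rw [tsum_eq_sum (s := Finset.range m)]
    · rw [Finset.card_filter]
      push_cast
      refine Finset.sum_congr rfl (fun k _ => ?_)
      simp [indicator]
    · intro k hk
      apply indicator_of_notMem
      intro h
      exact hk (Finset.mem_range.2 (hlt k h))

lemma cnt_sq_le {x : ℕ → ℝ} (hx : Monotone (ps x)) (hd : ∀ s : ℝ, ∃ m, s < ps x (m+1)) (r s : ℝ) :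
    cnt x r s ^ 2 ≤ ∑' k, ∑' i : ℕ, ((i:ℝ≥0∞)+1)^2 *
      ((Ioc r s).indicator 1 (ps x (k+1)) * (Ioc r s).indicator 1 (ps x (k+1+i))) := by
  obtain ⟨J, hJ, hc⟩ := cnt_finset hx hd r s
  rw [hc]
  rcases J.eq_empty_or_nonempty with rfl | hne
  · simp
  set a := J.min' hne
  set b := J.max' hne
  have hab : a ≤ b := Finset.min'_le _ _ (J.max'_mem hne)
  have hcard : J.card ≤ (b - a) + 1 := by
    have : J ⊆ Finset.Icc a b := fun k hk => Finset.mem_Icc.2 ⟨J.min'_le _ hk, J.le_max' _ hk⟩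
    have := Finset.card_le_card this
    simp at this; omega
  have ha := (hJ a).1 (J.min'_mem hne)
  have hb := (hJ b).1 (J.max'_mem hne)
  refine le_trans ?_ (ENNReal.le_tsum a)
  refine le_trans ?_ (ENNReal.le_tsum (b - a))
  rw [indicator_of_mem ha, indicator_of_mem (by rwa [show a + 1 + (b - a) = b + 1 by omega])]
  simp only [Pi.one_apply, mul_one]
  gcongr
  exact_mod_cast hcard

lemma cnt_prod_le {x : ℕ → ℝ} (hx : Monotone (ps x)) (hd : ∀ s : ℝ, ∃ m, s < ps x (m+1)) (r s t : ℝ) :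
    cnt x r s ^ 2 * cnt x s t ^ 2 ≤ ∑' k, ∑' i : ℕ, (i:ℝ≥0∞)^4 *
      ((Ioc r s).indicator 1 (ps x (k+1)) * (Ioc s t).indicator 1 (ps x (k+1+i))) := by
  obtain ⟨J, hJ, hc⟩ := cnt_finset hx hd r s
  obtain ⟨J', hJ', hc'⟩ := cnt_finset hx hd s t
  rw [hc, hc']
  rcases J.eq_empty_or_nonempty with rfl | hne
  · simp
  rcases J'.eq_empty_or_nonempty with rfl | hne'
  · simp
  set a := J.min' hne
  set b := J'.max' hne'
  have hlt : ∀ k ∈ J, ∀ l ∈ J', k < l := by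
    intro k hk l hl
    by_contra hcon
    have := hx (show l + 1 ≤ k + 1 by omega)
    have h1 := ((hJ k).1 hk).2
    have h2 := ((hJ' l).1 hl).1
    linarith
  have hcard : J.card ≤ (b - a) := by
    have : J ⊆ Finset.Ico a b := fun k hk => Finset.mem_Ico.2
      ⟨J.min'_le _ hk, hlt k hk b (J'.max'_mem hne')⟩
    have := Finset.card_le_card this
    simpa using this
  have hcard' : J'.card ≤ (b - a) := by
    have : J' ⊆ Finset.Ioc a b := fun k hk => Finset.mem_Ioc.2
      ⟨hlt a (J.min'_mem hne) k hk, J'.le_max' _ hk⟩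
    have := Finset.card_le_card this
    simpa using this
  have hab := hlt a (J.min'_mem hne) b (J'.max'_mem hne')
  have ha := (hJ a).1 (J.min'_mem hne)
  have hb := (hJ' b).1 (J'.max'_mem hne')
  refine le_trans ?_ (ENNReal.le_tsum a)
  refine le_trans ?_ (ENNReal.le_tsum (b - a))
  rw [indicator_of_mem ha, indicator_of_mem (by rwa [show a + 1 + (b - a) = b + 1 by omega])]
  simp only [Pi.one_apply, mul_one]
  calc (J.card:ℝ≥0∞)^2 * (J'.card:ℝ≥0∞)^2 ≤ ((b - a : ℕ):ℝ≥0∞)^2 * ((b - a : ℕ):ℝ≥0∞)^2 := by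
        gcongr
    _ = _ := by ring

lemma summable_geo {ρ : ℝ} (h0 : 0 ≤ ρ) (h1 : ρ < 1) (k : ℕ) :
    Summable (fun i : ℕ => ((i:ℝ)+1)^k * ρ^i) := by
  have hn : ‖ρ‖ < 1 := by rwa [Real.norm_eq_abs, abs_of_nonneg h0]
  have hs := ((summable_pow_mul_geometric_of_norm_lt_one k hn).add
    (summable_geometric_of_lt_one h0 h1)).mul_left (2^(k-1))
  refine Summable.of_nonneg_of_le (fun i => by positivity) (fun i => ?_) hs
  have := add_pow_le (Nat.cast_nonneg (α := ℝ) i) zero_le_one k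
  calc ((i:ℝ)+1)^k * ρ^i ≤ (2^(k-1) * ((i:ℝ)^k + 1^k)) * ρ^i := by gcongr
    _ = _ := by simp; ring

section
variable {Ω : Type*} [MeasurableSpace Ω] {P : Measure Ω} [IsProbabilityMeasure P]
  {ν : Measure ℝ} [IsProbabilityMeasure ν] {μ : ℝ} {η : ℕ → Ω → ℝ}

lemma ps_add (x : ℕ → ℝ) (k i : ℕ) : ps x (k+i) = ps x k + ∑ l ∈ Finset.Ico k (k+i), x l := by
  unfold ps
  rw [Finset.sum_range_add_sum_Ico _ (by omega)]

lemma Ren.indep_block (h : Ren P ν μ η) (k i : ℕ) :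
    IndepFun (fun ω => ps (fun i => η i ω) k) (fun ω => ∑ l ∈ Finset.Ico k (k+i), η l ω) P := by
  refine indep_dep (S := {i | i < k}) (T := {i | k ≤ i}) h.indep h.meas ?_ (f := fun x => ps x k)
    (g := fun x => ∑ l ∈ Finset.Ico k (k+i), x l) (measurable_ps k) (by fun_prop) ?_ ?_
  · rw [Set.disjoint_left]; intro a ha hb; simp at ha hb; omega
  · intro x y hxy
    exact Finset.sum_congr rfl (fun i hi => hxy i (by simpa using hi))
  · intro x y hxy
    exact Finset.sum_congr rfl (fun i hi => hxy i (by simp at hi; exact hi.1))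

lemma Ren.meas_block (h : Ren P ν μ η) (A : Finset ℕ) : Measurable (fun ω => ∑ l ∈ A, η l ω) :=
  Finset.measurable_sum _ (fun i _ => h.meas i)

/-- generic two-point bound -/
lemma Ren.two_point (h : Ren P ν μ η) {r s s' t : ℝ} (hr : 0 ≤ r) (w p : ℕ → ℝ≥0∞) (J : Set ℝ)
    (hJ : MeasurableSet J)
    (hJs : ∀ u ∈ Ioc r s, ∀ v ∈ Ioc s' t, u ≤ v → v - u ∈ J)
    (hp : ∀ k i, P {ω | ∑ l ∈ Finset.Ico (k+1) (k+1+i), η l ω ∈ J} ≤ p i) :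
    ∫⁻ ω, ∑' k, ∑' i : ℕ, w i *
      ((Ioc r s).indicator 1 (ps (fun i => η i ω) (k+1)) *
        (Ioc s' t).indicator 1 (ps (fun i => η i ω) (k+1+i))) ∂P
      ≤ (∑' i, w i * p i) * ENNReal.ofReal (μ * (s - r)) := by
  have hm1 : ∀ k, Measurable (fun ω => (Ioc r s).indicator (1 : ℝ → ℝ≥0∞) (ps (fun i => η i ω) (k+1))) :=
    fun k => (measurable_one.indicator measurableSet_Ioc).comp (h.meas_ps (k+1))
  have hm2 : ∀ k, Measurable (fun ω => (Ioc s' t).indicator (1 : ℝ → ℝ≥0∞) (ps (fun i => η i ω) k)) :=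
    fun k => (measurable_one.indicator measurableSet_Ioc).comp (h.meas_ps k)
  have hm12 : ∀ k i, Measurable (fun ω =>
      (Ioc r s).indicator (1 : ℝ → ℝ≥0∞) (ps (fun i => η i ω) (k+1)) *
      (Ioc s' t).indicator (1 : ℝ → ℝ≥0∞) (ps (fun i => η i ω) (k+1+i))) :=
    fun k i => (hm1 k).mul (hm2 (k+1+i))
  have hm13 : ∀ k i, Measurable (fun ω => w i * (
      (Ioc r s).indicator (1 : ℝ → ℝ≥0∞) (ps (fun i => η i ω) (k+1)) *
      (Ioc s' t).indicator (1 : ℝ → ℝ≥0∞) (ps (fun i => η i ω) (k+1+i)))) :=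
    fun k i => (hm12 k i).const_mul _
  rw [lintegral_tsum (fun k => (Measurable.tsum (fun i => hm13 k i)).aemeasurable)]
  rw [← h.palm_Ioc hr, ← ENNReal.tsum_mul_left]
  refine ENNReal.tsum_le_tsum (fun k => ?_)
  rw [lintegral_tsum (fun i => (hm13 k i).aemeasurable)]
  rw [← ENNReal.tsum_mul_right]
  refine ENNReal.tsum_le_tsum (fun i => ?_)
  rw [lintegral_const_mul _ (hm12 k i), mul_assoc]
  gcongr
  have hind := (h.indep_block (k+1) i).measure_inter_preimage_eq_mul _ _
    (measurableSet_Ioc (a := r) (b := s)) hJ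
  calc ∫⁻ ω, (Ioc r s).indicator 1 (ps (fun i => η i ω) (k+1)) *
        (Ioc s' t).indicator 1 (ps (fun i => η i ω) (k+1+i)) ∂P
      ≤ ∫⁻ ω, (((fun ω => ps (fun i => η i ω) (k+1)) ⁻¹' Ioc r s) ∩
        ((fun ω => ∑ l ∈ Finset.Ico (k+1) (k+1+i), η l ω) ⁻¹' J)).indicator 1 ω ∂P := by
        refine lintegral_mono (fun ω => ?_)
        by_cases h1 : ps (fun i => η i ω) (k+1) ∈ Ioc r s
        · by_cases h2 : ps (fun i => η i ω) (k+1+i) ∈ Ioc s' t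
          · have h3 := hJs _ h1 _ h2 (h.ps_mono ω (by omega))
            rw [ps_add, add_sub_cancel_left] at h3
            dsimp only
            rw [indicator_of_mem h1, indicator_of_mem h2, indicator_of_mem (by exact ⟨h1, h3⟩)]
            simp
          · simp [indicator_of_notMem h2]
        · simp [indicator_of_notMem h1]
    _ = P (((fun ω => ps (fun i => η i ω) (k+1)) ⁻¹' Ioc r s) ∩
        ((fun ω => ∑ l ∈ Finset.Ico (k+1) (k+1+i), η l ω) ⁻¹' J)) := by
        rw [lintegral_indicator_one]
        exact (h.meas_ps (k+1) measurableSet_Ioc).inter (h.meas_block _ hJ)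
    _ = _ := hind
    _ ≤ _ := by
        rw [mul_comm]
        exact mul_le_mul' (hp k i) le_rfl

lemma Ren.cnt_sq (h : Ren P ν μ η) : ∃ C : ℝ, 0 ≤ C ∧ ∀ r s : ℝ, 0 ≤ r → r ≤ s → s ≤ r + 1 →
    ∫⁻ ω, cnt (fun i => η i ω) r s ^ 2 ∂P ≤ ENNReal.ofReal (C * (s - r)) := by
  set p : ℕ → ℝ≥0∞ := fun i => ENNReal.ofReal (Real.exp 1 * rho ν ^ i) with hp
  have hfin : (∑' i : ℕ, ((i:ℝ≥0∞)+1)^2 * p i) ≠ ⊤ := by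
    have hs := ((summable_geo (rho_nonneg ν) h.rho_lt 2).mul_left (Real.exp 1)).tsum_ofReal_ne_top
    convert hs using 3 with i
    rw [hp]
    dsimp only
    have : ((i:ℝ≥0∞)+1)^2 = ENNReal.ofReal (((i:ℝ)+1)^2) := by
      rw [ENNReal.ofReal_pow (by positivity), ENNReal.ofReal_add (by positivity) (by norm_num)]
      simp
    rw [this, ← ENNReal.ofReal_mul (by positivity)]
    congr 1; ring
  refine ⟨(∑' i : ℕ, ((i:ℝ≥0∞)+1)^2 * p i).toReal * μ, mul_nonneg ENNReal.toReal_nonneg h.μpos.le, ?_⟩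
  intro r s hr hrs hs1
  have := h.two_point (s := s) (s' := r) (t := s) hr (fun i => ((i:ℝ≥0∞)+1)^2) p (Iic 1) measurableSet_Iic
    (by intro u hu v hv huv; simp; linarith [hu.1, hv.2])
    (by
      intro k i
      have := h.tail (Finset.Ico (k+1) (k+1+i)) (by simp) 1
      simpa using this)
  rw [mul_assoc, ENNReal.ofReal_mul ENNReal.toReal_nonneg, ENNReal.ofReal_toReal hfin]
  refine le_trans (lintegral_mono_ae ?_) this
  filter_upwards [h.diverge'] with ω hω
  exact cnt_sq_le (h.ps_mono ω) hω r s

lemma Ren.block_pos (h : Ren P ν μ η) {C : ℝ}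
    (hCν : ∀ T, 0 < T → T ≤ 1 → ν (Ioc 0 T) ≤ ENNReal.ofReal (C * T)) {T : ℝ} (hT0 : 0 < T)
    (hT : T ≤ 1) (A : Finset ℕ) (hA : 0 ∉ A) :
    P {ω | ∑ l ∈ A, η l ω ∈ Ioc 0 T} ≤
      A.card * (ENNReal.ofReal (C * T) * ENNReal.ofReal (Real.exp 1 * rho ν ^ (A.card - 1))) := by
  classical
  have hsub : {ω | ∑ l ∈ A, η l ω ∈ Ioc 0 T} ⊆
      ⋃ l ∈ A, (η l ⁻¹' Ioc 0 T) ∩ ((fun ω => ∑ i ∈ A.erase l, η i ω) ⁻¹' Iic 1) := by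
    intro ω hω
    obtain ⟨h1, h2⟩ := hω
    obtain ⟨l, hl, hl0⟩ : ∃ l ∈ A, 0 < η l ω := by
      by_contra hcon
      push Not at hcon
      have := Finset.sum_nonpos hcon
      linarith
    have h3 : η l ω ≤ ∑ i ∈ A, η i ω := Finset.single_le_sum (fun i _ => h.nonneg i ω) hl
    have h4 := Finset.add_sum_erase A (fun i => η i ω) hl
    simp only [mem_iUnion]
    refine ⟨l, hl, ⟨hl0, h3.trans h2⟩, ?_⟩
    simp only [mem_preimage, mem_Iic]
    linarith
  refine (measure_mono hsub).trans ((measure_biUnion_finset_le _ _).trans ?_)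
  rw [← nsmul_eq_mul]
  refine Finset.sum_le_card_nsmul _ _ _ (fun l hl => ?_)
  have hind : IndepFun (η l) (fun ω => ∑ i ∈ A.erase l, η i ω) P := by
    refine indep_dep (S := {l}) (T := {i | i ≠ l}) h.indep h.meas ?_ (f := fun x => x l)
      (g := fun x => ∑ i ∈ A.erase l, x i) (measurable_pi_apply l) (by fun_prop) ?_ ?_
    · simp
    · intro x y hxy; exact hxy l rfl
    · intro x y hxy
      exact Finset.sum_congr rfl (fun i hi => hxy i (by simp at hi; exact hi.1))
  rw [hind.measure_inter_preimage_eq_mul _ _ measurableSet_Ioc measurableSet_Iic]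
  gcongr
  · obtain ⟨j, rfl⟩ : ∃ j, l = j + 1 := Nat.exists_eq_succ_of_ne_zero (by rintro rfl; exact hA hl)
    rw [← Measure.map_apply (h.meas _) measurableSet_Ioc, h.law j]
    exact hCν T hT0 hT
  · have := h.tail (A.erase l) (by simp [hA]) 1
    rw [Finset.card_erase_of_mem hl] at this
    exact this

lemma Ren.cnt_prod (h : Ren P ν μ η) {C : ℝ} (hC : 0 ≤ C)
    (hCν : ∀ T, 0 < T → T ≤ 1 → ν (Ioc 0 T) ≤ ENNReal.ofReal (C * T)) :
    ∃ C' : ℝ, 0 ≤ C' ∧ ∀ r s t : ℝ, 0 ≤ r → r ≤ s → s ≤ t → t ≤ r + 1 →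
    ∫⁻ ω, cnt (fun i => η i ω) r s ^ 2 * cnt (fun i => η i ω) s t ^ 2 ∂P
      ≤ ENNReal.ofReal (C' * (t - r)^2) := by
  set q : ℕ → ℝ≥0∞ := fun i => i * ENNReal.ofReal (Real.exp 1 * rho ν ^ (i-1)) with hq
  have hfin : (∑' i : ℕ, (i:ℝ≥0∞)^4 * q i) ≠ ⊤ := by
    have hs0 : Summable (fun i : ℕ => Real.exp 1 * ((i:ℝ)^5 * rho ν ^ (i-1))) := by
      rw [← summable_nat_add_iff 1]
      have := ((summable_geo (rho_nonneg ν) h.rho_lt 5).mul_left (Real.exp 1))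
      refine this.congr (fun i => ?_)
      push_cast; simp
    convert hs0.tsum_ofReal_ne_top using 3 with i
    rw [hq]
    dsimp only
    have : (i:ℝ≥0∞)= ENNReal.ofReal (i:ℝ) := by simp
    have hρ := rho_nonneg ν
    rw [this, ← ENNReal.ofReal_pow (by positivity), ← ENNReal.ofReal_mul (by positivity),
      ← ENNReal.ofReal_mul (by positivity)]
    congr 1; ring
  refine ⟨(∑' i : ℕ, (i:ℝ≥0∞)^4 * q i).toReal * C * μ,
    mul_nonneg (mul_nonneg ENNReal.toReal_nonneg hC) h.μpos.le, ?_⟩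
  intro r s t hr hrs hst ht
  rcases (hrs.trans hst).eq_or_lt with hrt | hrt
  · have hs : s = r := by linarith
    subst hs
    simp [cnt]
  have := h.two_point (s := s) (s' := s) (t := t) hr (fun i => (i:ℝ≥0∞)^4)
    (fun i => ENNReal.ofReal (C * (t - r)) * q i) (Ioc 0 (t - r)) measurableSet_Ioc
    (by intro u hu v hv huv; simp; constructor <;> linarith [hu.1, hv.2, hu.2, hv.1])
    (by
      intro k i
      have := h.block_pos hCν (sub_pos.2 hrt) (by linarith) (Finset.Ico (k+1) (k+1+i)) (by simp)
      refine this.trans (le_of_eq ?_)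
      simp only [Nat.card_Ico, add_tsub_cancel_left, hq]
      ring)
  refine le_trans (lintegral_mono_ae ?_) (this.trans ?_)
  · filter_upwards [h.diverge'] with ω hω
    exact cnt_prod_le (h.ps_mono ω) hω r s t
  · have e : ∀ i : ℕ, (i:ℝ≥0∞)^4 * (ENNReal.ofReal (C * (t - r)) * q i)
        = ENNReal.ofReal (C * (t - r)) * ((i:ℝ≥0∞)^4 * q i) := fun i => by ring
    simp_rw [e]
    rw [ENNReal.tsum_mul_left]
    have : 0 ≤ t - r := by linarith
    calc ENNReal.ofReal (C * (t - r)) * (∑' i : ℕ, (i:ℝ≥0∞)^4 * q i) * ENNReal.ofReal (μ * (s - r))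
       ≤ ENNReal.ofReal (C * (t - r)) * (∑' i : ℕ, (i:ℝ≥0∞)^4 * q i) * ENNReal.ofReal (μ * (t - r)) := by
          have := h.μpos
          gcongr
      _ = _ := by
          nth_rewrite 1 [← ENNReal.ofReal_toReal hfin]
          rw [← ENNReal.ofReal_mul (by positivity), ← ENNReal.ofReal_mul (by positivity)]
          congr 1; ring

end
end RenAux

namespace RenAux
open scoped ENNReal NNReal

noncomputable def Hf (r s : ℝ) (i : ℕ) (x : ℕ → ℝ) : ℝ := (Ioc r s).indicator 1 (ps x (i+1))
noncomputable def Kf (r s : ℝ) (m : ℕ) (x : ℕ → ℝ) : ℝ := ∑ i ∈ Finset.range m, Hf r s i x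
noncomputable def Lf (r s T κ : ℝ) (m : ℕ) (x : ℕ → ℝ) : ℝ :=
  ∑ i ∈ Finset.range m, Hf r s i x * (κ - min (x (i+1)) T)
noncomputable def Wf (r s T : ℝ) (m : ℕ) (x : ℕ → ℝ) : ℝ :=
  ∑ i ∈ Finset.range m, Hf r s i x * min (x (i+1)) T
noncomputable def Ef (r s T : ℝ) (m : ℕ) (x : ℕ → ℝ) : ℝ :=
  ∑ i ∈ Finset.range m, Hf r s i x * (min (x (i+1)) T)^4
noncomputable def Rt (r T : ℝ) (i : ℕ) (x : ℕ → ℝ) : ℝ :=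
  if ps x (i+1) ≤ r ∧ r < ps x (i+2) then (min (ps x (i+2) - r) T)^4 else 0
noncomputable def Rf (r T : ℝ) (m : ℕ) (x : ℕ → ℝ) : ℝ :=
  (min (x 0) T)^4 + ∑ i ∈ Finset.range m, Rt r T i x

lemma Hf_nonneg (r s : ℝ) (i : ℕ) (x : ℕ → ℝ) : 0 ≤ Hf r s i x := by
  unfold Hf indicator; split_ifs <;> simp

lemma Hf_le_one (r s : ℝ) (i : ℕ) (x : ℕ → ℝ) : Hf r s i x ≤ 1 := by
  unfold Hf indicator; split_ifs <;> simp

lemma Hf_sq (r s : ℝ) (i : ℕ) (x : ℕ → ℝ) : Hf r s i x ^ 2 = Hf r s i x := by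
  unfold Hf indicator; split_ifs <;> simp

lemma Hf_one {r s : ℝ} {i : ℕ} {x : ℕ → ℝ} (h : ps x (i+1) ∈ Ioc r s) : Hf r s i x = 1 := by
  simp [Hf, indicator_of_mem h]

lemma Hf_zero {r s : ℝ} {i : ℕ} {x : ℕ → ℝ} (h : ps x (i+1) ∉ Ioc r s) : Hf r s i x = 0 := by
  simp [Hf, indicator_of_notMem h]

lemma kap_K (r s T κ : ℝ) (m : ℕ) (x : ℕ → ℝ) :
    κ * Kf r s m x = Lf r s T κ m x + Wf r s T m x := by
  unfold Kf Lf Wf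
  rw [Finset.mul_sum, ← Finset.sum_add_distrib]
  refine Finset.sum_congr rfl (fun i _ => by ring)

lemma Wf_nonneg {r s T : ℝ} (m : ℕ) {x : ℕ → ℝ} (hx : ∀ i, 0 ≤ x i) (hT : 0 ≤ T) :
    0 ≤ Wf r s T m x :=
  Finset.sum_nonneg (fun i _ => mul_nonneg (Hf_nonneg _ _ _ _) (le_min (hx _) hT))

lemma Wf_le {r s T : ℝ} (m : ℕ) {x : ℕ → ℝ} (hx : ∀ i, 0 ≤ x i) (hT : 0 ≤ T) (hrs : s - r ≤ T) :
    Wf r s T m x ≤ max (ps x (m+1) - r) 0 ∧ Wf r s T m x ≤ 2 * T := by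
  induction m with
  | zero => simp [Wf, hT]
  | succ m ih =>
    have e : Wf r s T (m+1) x = Wf r s T m x + Hf r s m x * min (x (m+1)) T :=
      Finset.sum_range_succ _ _
    have ep : ps x (m+1+1) = ps x (m+1) + x (m+1) := ps_succ _ _
    have hb1 := min_le_left (x (m+1)) T
    have hb2 := min_le_right (x (m+1)) T
    by_cases hh : ps x (m+1) ∈ Ioc r s
    · rw [Hf_one hh] at e
      have h1 := hh.1
      have h2 := hh.2
      rw [max_eq_left (by linarith)] at ih
      rw [max_eq_left (by linarith [hx (m+1)])]
      constructor <;> linarith [ih.1]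
    · rw [Hf_zero hh] at e
      rw [e, zero_mul, add_zero]
      refine ⟨ih.1.trans (max_le_max (by linarith [hx (m+1)]) le_rfl), ih.2⟩

lemma Ef_nonneg {r s T : ℝ} (m : ℕ) {x : ℕ → ℝ} : 0 ≤ Ef r s T m x :=
  Finset.sum_nonneg (fun i _ => mul_nonneg (Hf_nonneg _ _ _ _) (by positivity))

lemma Rt_nonneg {r T : ℝ} (m : ℕ) {x : ℕ → ℝ} : 0 ≤ Rt r T m x := by
  unfold Rt; split_ifs <;> positivity

lemma Rf_nonneg {r T : ℝ} (m : ℕ) {x : ℕ → ℝ} : 0 ≤ Rf r T m x :=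
  add_nonneg (by positivity) (Finset.sum_nonneg (fun i _ => Rt_nonneg i))

lemma pow4_le_of {a b : ℝ} (h1 : a ≤ b) (h2 : -b ≤ a) : a ^ 4 ≤ b ^ 4 :=
  pow_le_pow_left_of_abs h1 h2
where
  pow_le_pow_left_of_abs (h1 : a ≤ b) (h2 : -b ≤ a) : a ^ 4 ≤ b ^ 4 := by
    have h : a ^ 2 ≤ b ^ 2 := sq_le_sq' h2 h1
    nlinarith [sq_nonneg a, sq_nonneg b]

lemma W_dev {r s T : ℝ} (m : ℕ) {x : ℕ → ℝ} (hx : ∀ i, 0 ≤ x i) (hT : 0 ≤ T) (hr : 0 ≤ r)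
    (hrs : r ≤ s) (hrsT : s - r ≤ T) :
    (ps x (m+1) ≤ r → Wf r s T m x = 0) ∧
    (ps x (m+1) ∈ Ioc r s → Wf r s T m x ≤ ps x (m+1) - r ∧
      (ps x (m+1) - r - Wf r s T m x)^4 ≤ Rf r T m x) ∧
    (s < ps x (m+1) → (Wf r s T m x - (s - r))^4 ≤ Rf r T m x + Ef r s T m x) := by
  induction m with
  | zero =>
    have e0 : ps x (0+1) = x 0 := by simp [ps]
    have eR : Rf r T 0 x = (min (x 0) T)^4 := by simp [Rf]
    have eE : Ef r s T 0 x = 0 := by simp [Ef]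
    have eW : Wf r s T 0 x = 0 := by simp [Wf]
    rw [e0, eR, eE, eW]
    refine ⟨fun _ => rfl, fun h => ⟨by linarith [h.1], ?_⟩, fun h => ?_⟩
    · apply pow4_le_of
      · rw [sub_zero]; exact le_min (by linarith) (by linarith [h.2])
      · have : 0 ≤ min (x 0) T := le_min (hx 0) hT
        linarith [h.1]
    · rw [add_zero]
      have : s - r ≤ min (x 0) T := le_min (by linarith) (by linarith)
      apply pow4_le_of <;> linarith
  | succ m ih =>
    have eW : Wf r s T (m+1) x = Wf r s T m x + Hf r s m x * min (x (m+1)) T :=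
      Finset.sum_range_succ _ _
    have eE : Ef r s T (m+1) x = Ef r s T m x + Hf r s m x * (min (x (m+1)) T)^4 :=
      Finset.sum_range_succ _ _
    have eR : Rf r T (m+1) x = Rf r T m x + Rt r T m x := by
      unfold Rf; rw [Finset.sum_range_succ]; ring
    have ep : ps x (m+1+1) = ps x (m+1) + x (m+1) := ps_succ _ _
    have hxm := hx (m+1)
    have hR0 : 0 ≤ Rf r T m x := Rf_nonneg m
    have hE0 : 0 ≤ Ef r s T m x := Ef_nonneg m
    have hRt0 : 0 ≤ Rt r T m x := Rt_nonneg m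
    obtain ⟨i1, i2, i3⟩ := ih
    have hH0 := Hf_nonneg r s m x
    have hE1 : Ef r s T m x ≤ Ef r s T (m+1) x := by
      rw [eE]; linarith [mul_nonneg hH0 (by positivity : (0:ℝ) ≤ (min (x (m+1)) T)^4)]
    rcases le_or_gt (ps x (m+1)) r with h1 | h1
    · -- currently before r
      have hz : Hf r s m x = 0 := Hf_zero (fun h => by linarith [h.1])
      have hW : Wf r s T (m+1) x = 0 := by rw [eW, hz, i1 h1]; ring
      rw [hW]
      have hRt : r < ps x (m+1+1) → Rt r T m x = (min (ps x (m+2) - r) T)^4 := by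
        intro h; unfold Rt; rw [if_pos ⟨h1, h⟩]
      refine ⟨fun _ => rfl, fun h => ⟨by linarith [h.1], ?_⟩, fun h => ?_⟩
      · rw [eR, hRt h.1]
        have : min (ps x (m+2) - r) T = ps x (m+2) - r := min_eq_left (by
          have := h.2; change ps x (m+2) ≤ s at this; linarith)
        rw [this, sub_zero]
        change (ps x (m+2) - r)^4 ≤ _
        linarith
      · have h' : s < ps x (m+2) := h
        rw [eR, hRt (by linarith)]
        have h2 : s - r ≤ min (ps x (m+2) - r) T := le_min (by linarith) hrsT
        have h3 : (0 - (s-r))^4 ≤ (min (ps x (m+2) - r) T)^4 := by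
          apply pow4_le_of <;> linarith
        linarith
    · rcases le_or_gt (ps x (m+1)) s with h2 | h2
      · have hz : Hf r s m x = 1 := Hf_one ⟨h1, h2⟩
        obtain ⟨j1, j2⟩ := i2 ⟨h1, h2⟩
        rw [hz, one_mul] at eW eE
        refine ⟨fun h => by linarith, fun h => ?_, fun h => ?_⟩
        · have hxT : min (x (m+1)) T = x (m+1) := min_eq_left (by linarith [h.2])
          rw [hxT] at eW
          constructor
          · linarith
          · have : ps x (m+1+1) - r - Wf r s T (m+1) x = ps x (m+1) - r - Wf r s T m x := by
              rw [eW, ep]; ring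
            rw [this, eR]; linarith
        · -- exit
          set b := min (x (m+1)) T with hb
          have hb0 : 0 ≤ b := le_min hxm hT
          have hge : s - r ≤ ps x (m+1) - r + b := by
            rcases min_choice (x (m+1)) T with hc | hc
            · rw [hb, hc]; linarith
            · rw [hb, hc]; linarith
          rw [eW, eE, eR]
          rcases le_total 0 (Wf r s T m x + b - (s - r)) with hs | hs
          · have : (Wf r s T m x + b - (s - r))^4 ≤ b^4 := by
              apply pow4_le_of <;> linarith
            linarith
          · have : (Wf r s T m x + b - (s - r))^4 ≤ (ps x (m+1) - r - Wf r s T m x)^4 := by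
              apply pow4_le_of <;> linarith
            linarith [(by positivity : (0:ℝ) ≤ b^4)]
      · have hz : Hf r s m x = 0 := Hf_zero (fun h => by linarith [h.2])
        rw [hz, zero_mul, add_zero] at eW
        refine ⟨fun h => by linarith, fun h => by linarith [h.2], fun h => ?_⟩
        have := i3 h2
        rw [eW, eR]; linarith

lemma Kf_cnt {r s : ℝ} {m : ℕ} {x : ℕ → ℝ} (hx : Monotone (ps x)) (hs : s < ps x (m+1)) :
    (cnt x r s).toReal = Kf r s m x := by
  unfold cnt Kf
  rw [tsum_eq_sum (s := Finset.range m)]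
  · rw [ENNReal.toReal_sum]
    · refine Finset.sum_congr rfl (fun i _ => ?_)
      unfold Hf indicator; split_ifs <;> simp
    · intro i _
      unfold indicator; split_ifs <;> simp
  · intro k hk
    apply indicator_of_notMem
    intro h
    have := hx (show m + 1 ≤ k + 1 by simp at hk; omega)
    linarith [h.2]

lemma Hf_dep {r s : ℝ} {i m : ℕ} (him : i ≤ m) (x y : ℕ → ℝ) (hxy : ∀ i ∈ {i | i ≤ m}, x i = y i) :
    Hf r s i x = Hf r s i y := by
  unfold Hf
  congr 1
  exact Finset.sum_congr rfl (fun j hj => hxy j (by simp at hj ⊢; omega))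

lemma Kf_dep {r s : ℝ} {m : ℕ} (x y : ℕ → ℝ) (hxy : ∀ i ∈ {i | i ≤ m}, x i = y i) :
    Kf r s m x = Kf r s m y :=
  Finset.sum_congr rfl (fun j hj => Hf_dep (by simp at hj; omega) x y hxy)

lemma Lf_dep {r s T κ : ℝ} {m : ℕ} (x y : ℕ → ℝ) (hxy : ∀ i ∈ {i | i ≤ m}, x i = y i) :
    Lf r s T κ m x = Lf r s T κ m y :=
  Finset.sum_congr rfl (fun j hj => by
    rw [Hf_dep (m := m) (by simp at hj; omega) x y hxy, hxy (j+1) (by simp at hj ⊢; omega)])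

lemma measurable_Hf (r s : ℝ) (i : ℕ) : Measurable (Hf r s i) :=
  (measurable_one.indicator measurableSet_Ioc).comp (measurable_ps (i+1))

lemma measurable_Kf (r s : ℝ) (m : ℕ) : Measurable (Kf r s m) :=
  Finset.measurable_sum _ (fun i _ => measurable_Hf r s i)

lemma measurable_Lf (r s T κ : ℝ) (m : ℕ) : Measurable (Lf r s T κ m) :=
  Finset.measurable_sum _ (fun i _ => (measurable_Hf r s i).mul (by fun_prop))

lemma measurable_Ef (r s T : ℝ) (m : ℕ) : Measurable (Ef r s T m) :=
  Finset.measurable_sum _ (fun i _ => (measurable_Hf r s i).mul (by fun_prop))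

lemma measurable_Rt (r T : ℝ) (i : ℕ) : Measurable (Rt r T i) := by
  have h1 := measurable_ps (i+1)
  have h2 := measurable_ps (i+2)
  unfold Rt
  refine Measurable.ite ?_ (by fun_prop) measurable_const
  exact (measurableSet_le h1 measurable_const).inter (measurableSet_lt measurable_const h2)

end RenAux

namespace RenAux
open scoped ENNReal NNReal
section
variable {Ω : Type*} [MeasurableSpace Ω] {P : Measure Ω} [IsProbabilityMeasure P]
  {ν : Measure ℝ} [IsProbabilityMeasure ν] {μ : ℝ} {η : ℕ → Ω → ℝ}

/-- bounded measurable -/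
def BM (f : Ω → ℝ) : Prop := Measurable f ∧ ∃ B, ∀ ω, |f ω| ≤ B

lemma BM.mul {f g : Ω → ℝ} (hf : BM f) (hg : BM g) : BM (fun ω => f ω * g ω) := by
  obtain ⟨h1, A, hA⟩ := hf
  obtain ⟨h2, B, hB⟩ := hg
  refine ⟨h1.mul h2, A * B, fun ω => ?_⟩
  rw [abs_mul]
  exact mul_le_mul (hA ω) (hB ω) (abs_nonneg _) ((abs_nonneg _).trans (hA ω))

lemma BM.add {f g : Ω → ℝ} (hf : BM f) (hg : BM g) : BM (fun ω => f ω + g ω) := by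
  obtain ⟨h1, A, hA⟩ := hf
  obtain ⟨h2, B, hB⟩ := hg
  refine ⟨h1.add h2, A + B, fun ω => (abs_add_le _ _).trans (add_le_add (hA ω) (hB ω))⟩

lemma BM.const (c : ℝ) : BM (fun _ : Ω => c) := ⟨measurable_const, |c|, fun _ => le_rfl⟩

lemma BM.cmul {g : Ω → ℝ} (c : ℝ) (hg : BM g) : BM (fun ω => c * g ω) := (BM.const c).mul hg

lemma BM.sub {f g : Ω → ℝ} (hf : BM f) (hg : BM g) : BM (fun ω => f ω - g ω) := by
  have := hf.add (hg.cmul (-1))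
  convert this using 2; ring

lemma BM.pow {f : Ω → ℝ} (hf : BM f) (n : ℕ) : BM (fun ω => f ω ^ n) := by
  induction n with
  | zero => simpa using BM.const 1
  | succ n ih => simpa [pow_succ] using ih.mul hf

lemma BM.int {f : Ω → ℝ} (hf : BM f) : Integrable f P := by
  obtain ⟨h1, A, hA⟩ := hf
  exact Integrable.of_bound h1.aestronglyMeasurable A (Eventually.of_forall hA)

lemma BM.sum {ι : Type*} (s : Finset ι) {f : ι → Ω → ℝ} (hf : ∀ i ∈ s, BM (f i)) :
    BM (fun ω => ∑ i ∈ s, f i ω) := by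
  classical
  induction s using Finset.induction_on with
  | empty => simpa using BM.const 0
  | insert a s ha ih =>
    have := (hf a (by simp)).add (ih (fun i hi => hf i (by simp [hi])))
    simpa [Finset.sum_insert ha] using this

lemma step_ineq {K L H D : Ω → ℝ} (hK : BM K) (hL : BM L) (hH : BM H) (hD : BM D)
    (hK0 : ∀ ω, 0 ≤ K ω) (hH0 : ∀ ω, 0 ≤ H ω) (hH2 : ∀ ω, H ω ^ 2 = H ω)
    (hind : ∀ (g : ℝ → ℝ → ℝ → ℝ) (φ : ℝ → ℝ), Measurable (fun q : ℝ × ℝ × ℝ => g q.1 q.2.1 q.2.2) → Measurable φ →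
      ∫ ω, g (K ω) (L ω) (H ω) * φ (D ω) ∂P = (∫ ω, g (K ω) (L ω) (H ω) ∂P) * ∫ ω, φ (D ω) ∂P)
    {C3 C T : ℝ} (h1 : ∫ ω, D ω ∂P = 0) (h2 : ∫ ω, D ω ^ 2 ∂P ≤ 1 + C3)
    (h3 : |∫ ω, D ω ^ 3 ∂P| ≤ C3) (h4 : ∫ ω, D ω ^ 4 ∂P ≤ T * C3) (hT : 1 ≤ T)
    (hC : C = 6 * (1 + C3) + 2 * C3) :
    ∫ ω, ((L ω + H ω * D ω)^4 - C * (K ω + H ω) * (L ω + H ω * D ω)^2 - C * T * (K ω + H ω)) ∂P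
      ≤ ∫ ω, ((L ω)^4 - C * (K ω) * (L ω)^2 - C * T * (K ω)) ∂P := by
  have hC30 : 0 ≤ C3 := (abs_nonneg _).trans h3
  have hD2 : 0 ≤ ∫ ω, D ω ^ 2 ∂P := integral_nonneg (fun ω => sq_nonneg _)
  have hC0 : 0 ≤ C := by rw [hC]; positivity
  set A1 : Ω → ℝ := fun ω => 4 * L ω ^ 3 * H ω - C * (2 * K ω * L ω * H ω + 2 * L ω * H ω) with hA1
  set A2 : Ω → ℝ := fun ω => 6 * L ω ^ 2 * H ω - C * (K ω * H ω + H ω) with hA2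
  set A3 : Ω → ℝ := fun ω => 4 * L ω * H ω with hA3
  set A0 : Ω → ℝ := fun ω => C * (H ω * L ω ^ 2) + C * T * H ω with hA0
  have bA1 : BM A1 := (((hL.pow 3).cmul 4).mul hH).sub
    ((((((hK.cmul 2).mul hL).mul hH).add ((hL.cmul 2).mul hH))).cmul C)
  have bA2 : BM A2 := (((hL.pow 2).cmul 6).mul hH).sub (((hK.mul hH).add hH).cmul C)
  have bA3 : BM A3 := (hL.cmul 4).mul hH
  have bA0 : BM A0 := ((hH.mul (hL.pow 2)).cmul C).add (hH.cmul (C * T))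
  have bB : BM (fun ω => (L ω)^4 - C * (K ω) * (L ω)^2 - C * T * (K ω)) :=
    ((hL.pow 4).sub ((hK.cmul C).mul (hL.pow 2))).sub (hK.cmul (C*T))
  have e : ∀ ω, (L ω + H ω * D ω)^4 - C * (K ω + H ω) * (L ω + H ω * D ω)^2 - C * T * (K ω + H ω)
      = ((L ω)^4 - C * (K ω) * (L ω)^2 - C * T * (K ω)) + (A1 ω * D ω + A2 ω * D ω ^ 2
        + A3 ω * D ω ^ 3 + H ω * D ω ^ 4 - A0 ω) := by
    intro ω
    have q2 := hH2 ω
    have q3 : H ω ^ 3 = H ω := by rw [pow_succ, q2, ← sq, q2]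
    have q4 : H ω ^ 4 = H ω := by rw [pow_succ, q3, ← sq, q2]
    simp only [hA1, hA2, hA3, hA0]
    linear_combination (6 * L ω ^2 * D ω^2 - C * (2 * L ω * D ω + K ω * D ω ^2)) * q2
      + (4 * L ω * D ω^3 - C * D ω^2) * q3 + D ω ^4 * q4
  simp_rw [e]
  have b1 := bA1.mul hD
  have b2 := bA2.mul (hD.pow 2)
  have b3 := bA3.mul (hD.pow 3)
  have b4 := hH.mul (hD.pow 4)
  rw [integral_add bB.int ((((b1.add b2).add b3).add b4).sub bA0).int,
    integral_sub (((b1.add b2).add b3).add b4).int bA0.int,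
    integral_add ((b1.add b2).add b3).int b4.int,
    integral_add (b1.add b2).int b3.int, integral_add b1.int b2.int]
  rw [hind (fun k l h => 4 * l ^ 3 * h - C * (2 * k * l * h + 2 * l * h)) (fun d => d) (by fun_prop) (by fun_prop),
    hind (fun k l h => 6 * l ^ 2 * h - C * (k * h + h)) (fun d => d^2) (by fun_prop) (by fun_prop),
    hind (fun k l h => 4 * l * h) (fun d => d^3) (by fun_prop) (by fun_prop),
    hind (fun k l h => h) (fun d => d^4) (by fun_prop) (by fun_prop), h1]
  set s2 := ∫ ω, D ω ^ 2 ∂P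
  set s3 := ∫ ω, D ω ^ 3 ∂P
  set s4 := ∫ ω, D ω ^ 4 ∂P
  rw [mul_zero, zero_add, ← integral_mul_const, ← integral_mul_const, ← integral_mul_const,
    ← integral_add (bA2.mul (BM.const s2)).int (bA3.mul (BM.const s3)).int,
    ← integral_add ((bA2.mul (BM.const s2)).add (bA3.mul (BM.const s3))).int (hH.mul (BM.const s4)).int,
    ← integral_sub (((bA2.mul (BM.const s2)).add (bA3.mul (BM.const s3))).add (hH.mul (BM.const s4))).int bA0.int]
  have : ∫ ω, (A2 ω * s2 + A3 ω * s3 + H ω * s4 - A0 ω) ∂P ≤ 0 := by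
    apply integral_nonpos
    intro ω
    simp only [hA2, hA3, hA0, Pi.zero_apply]
    have f1 : 4 * s3 * L ω ≤ 2 * C3 * (1 + L ω ^ 2) := by
      have := abs_le.1 h3
      nlinarith [mul_nonneg (by linarith : 0 ≤ C3 - s3) (sq_nonneg (1 + L ω)),
        mul_nonneg (by linarith : 0 ≤ C3 + s3) (sq_nonneg (1 - L ω))]
    have f2 : 6 * s2 * L ω ^ 2 ≤ 6 * (1 + C3) * L ω ^ 2 := by
      have := mul_le_mul_of_nonneg_right h2 (sq_nonneg (L ω)); linarith
    have f3 : 0 ≤ C * (K ω + 1) * s2 := by have := hK0 ω; positivity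
    have f4 : 2 * C3 + T * C3 ≤ C * T := by
      rw [hC]; nlinarith [mul_nonneg hC30 (by linarith : 0 ≤ T - 1)]
    have : H ω * (6 * s2 * L ω ^2 + 4 * s3 * L ω + s4 - C * (K ω + 1) * s2 - C * L ω ^2 - C * T) ≤ 0 := by
      apply mul_nonpos_of_nonneg_of_nonpos (hH0 ω)
      rw [hC] at *
      nlinarith
    linarith
  have e5 : (fun ω => A2 ω * s2 + A3 ω * s3 + H ω * s4 - A0 ω) = fun ω => (6 * L ω ^ 2 * H ω - C * (K ω * H ω + H ω)) * s2 + 4 * L ω * H ω * s3 + H ω * s4 - A0 ω := rfl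
  rw [e5] at this
  linarith

lemma L4_arith {L K c T κ C : ℝ} (hκ : 0 < κ) (hc : c = C / κ) (hC : 0 ≤ C) (hT : 1 ≤ T)
    (hK : κ * K ≤ |L| + 2 * T) :
    C * K * L^2 + C * T * K ≤ 3/4 * L^4 + ((c^2+2*c)^2 + 2*c + c^2/2 + 1/4) * T^2 := by
  have hc0 : 0 ≤ c := by rw [hc]; positivity
  have hCc : C = c * κ := by rw [hc]; field_simp
  have h1 : C * K ≤ c * (|L| + 2*T) := by
    rw [hCc, mul_assoc]; exact mul_le_mul_of_nonneg_left hK hc0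
  have hL2 : L^2 = |L|^2 := (sq_abs L).symm
  have hL4 : L^4 = |L|^4 := by rw [show L^4 = (L^2)^2 by ring, hL2]; ring
  rw [hL4, hL2]
  have hl := abs_nonneg L
  set l := |L|
  have h2 : C * K * l^2 + C * T * K ≤ c * (l + 2*T) * l^2 + c * (l + 2*T) * T := by
    have a1 := mul_le_mul_of_nonneg_right h1 (sq_nonneg l)
    have a2 := mul_le_mul_of_nonneg_right h1 (by linarith : 0 ≤ T)
    linarith
  have h3 : c * l * l^2 ≤ l^4/4 + c^2 * l^2 := by nlinarith [sq_nonneg (l^2/2 - c*l)]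
  have h4 : (c^2 + 2*c*T) * l^2 ≤ l^4/4 + (c^2+2*c*T)^2 := by
    nlinarith [sq_nonneg (l^2/2 - (c^2+2*c*T))]
  have h5 : (c^2+2*c*T)^2 ≤ (c^2+2*c)^2 * T^2 := by
    rw [← mul_pow]
    refine pow_le_pow_left₀ (by positivity) ?_ 2
    nlinarith [mul_nonneg (sq_nonneg c) (by linarith : 0 ≤ T - 1)]
  have h6 : c * l * T ≤ c^2/2 * T^2 + l^4/4 + 1/4 := by
    nlinarith [sq_nonneg (c*T - l), sq_nonneg (l^2 - 1)]
  have h7 : (1:ℝ)/4 ≤ 1/4 * T^2 := by nlinarith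
  nlinarith

end
end RenAux

namespace RenAux
open scoped ENNReal NNReal
section
variable {Ω : Type*} [MeasurableSpace Ω] {P : Measure Ω} [IsProbabilityMeasure P]
  {ν : Measure ℝ} [IsProbabilityMeasure ν] {μ : ℝ} {η : ℕ → Ω → ℝ}

noncomputable def kap (ν : Measure ℝ) (T : ℝ) : ℝ := ∫ x, min x T ∂ν
noncomputable def m3 (ν : Measure ℝ) : ℝ := ∫ x, x ^ 3 ∂ν

lemma Ren.int1 (h : Ren P ν μ η) : Integrable (fun x : ℝ => x) ν := by
  refine ((integrable_const (1:ℝ)).add h.int3.norm).mono' (by fun_prop) ?_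
  filter_upwards with x
  simp only [Real.norm_eq_abs, Pi.add_apply, abs_pow]
  have := abs_nonneg x
  rcases le_total (|x|) 1 with h1 | h1
  · have : 0 ≤ |x|^3 := by positivity
    linarith
  · nlinarith [mul_nonneg this (by nlinarith : 0 ≤ |x|^2 - 1)]

lemma Ren.int2 (h : Ren P ν μ η) : Integrable (fun x : ℝ => x^2) ν := by
  refine ((integrable_const (1:ℝ)).add h.int3.norm).mono' (by fun_prop) ?_
  filter_upwards with x
  simp only [Real.norm_eq_abs, Pi.add_apply, abs_pow]
  have := abs_nonneg x
  rcases le_total (|x|) 1 with h1 | h1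
  · have : 0 ≤ |x|^3 := by positivity
    nlinarith
  · nlinarith [mul_nonneg (sq_nonneg (|x|)) (by linarith : 0 ≤ |x| - 1)]

lemma Ren.int_min (h : Ren P ν μ η) {T : ℝ} (hT : 0 ≤ T) : Integrable (fun x : ℝ => min x T) ν := by
  refine Integrable.of_bound (by fun_prop) T ?_
  filter_upwards [h.supp] with x hx
  rw [Real.norm_eq_abs, abs_of_nonneg (le_min hx hT)]
  exact min_le_right _ _

lemma Ren.kap_pos (h : Ren P ν μ η) : 0 < kap ν 1 := by
  have hI := h.int_min zero_le_one
  have h1 : 0 ≤ᵐ[ν] fun x => min x 1 := by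
    filter_upwards [h.supp] with x hx
    exact le_min hx zero_le_one
  by_contra hcon
  have h3 : ∫ x, min x 1 ∂ν = 0 := le_antisymm (not_lt.1 hcon) (integral_nonneg_of_ae h1)
  rw [integral_eq_zero_iff_of_nonneg_ae h1 hI] at h3
  have h4 : (fun x : ℝ => x) =ᵐ[ν] 0 := by
    filter_upwards [h3] with x hx
    have hx' : min x 1 = 0 := hx
    rcases min_choice x 1 with hc | hc
    · rw [hc] at hx'; exact hx'
    · rw [hc] at hx'; norm_num at hx'
  have h5 := integral_congr_ae h4
  rw [h.mean] at h5
  have := h.μpos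
  simp at h5
  linarith

lemma Ren.kap_mono (h : Ren P ν μ η) {T : ℝ} (hT : 1 ≤ T) : kap ν 1 ≤ kap ν T :=
  integral_mono (h.int_min zero_le_one) (h.int_min (by linarith)) (fun x => min_le_min_left _ hT)

lemma Ren.kap_le (h : Ren P ν μ η) {T : ℝ} (hT : 1 ≤ T) : kap ν T ≤ 1 / μ := by
  rw [← h.mean]
  exact integral_mono (h.int_min (by linarith)) h.int1 (fun x => min_le_left _ _)

lemma Ren.kap_le_T (h : Ren P ν μ η) {T : ℝ} (hT : 1 ≤ T) : kap ν T ≤ T := by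
  have := integral_mono (h.int_min (T := T) (by linarith)) (integrable_const (T:ℝ)) (fun x => min_le_right _ _)
  simpa [kap] using this

lemma Ren.m3_nonneg (h : Ren P ν μ η) : 0 ≤ m3 ν := by
  refine integral_nonneg_of_ae ?_
  filter_upwards [h.supp] with x hx
  exact pow_nonneg hx 3

lemma Ren.kap_gap (h : Ren P ν μ η) {T : ℝ} (hT : 1 ≤ T) :
    1 / μ - kap ν T ≤ (∫ x, x^2 ∂ν) / T := by
  rw [← h.mean, kap, ← integral_sub h.int1 (h.int_min (by linarith)), ← integral_div]
  refine integral_mono (h.int1.sub (h.int_min (by linarith))) (h.int2.div_const _) (fun x => ?_)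
  simp only
  rw [le_div_iff₀ (by linarith)]
  rcases le_total x T with hx | hx
  · rw [min_eq_left hx]; nlinarith [sq_nonneg x]
  · rw [min_eq_right hx]; nlinarith [mul_nonneg (by linarith : 0 ≤ x) (by linarith : 0 ≤ T)]

/-- moments of the centred truncated variable -/
lemma Ren.dmom (h : Ren P ν μ η) {T : ℝ} (hT : 1 ≤ T) :
    ∫ x, (kap ν T - min x T) ∂ν = 0 ∧
    ∫ x, (kap ν T - min x T)^2 ∂ν ≤ 1 + ((1/μ)^3 + m3 ν) ∧
    |∫ x, (kap ν T - min x T)^3 ∂ν| ≤ (1/μ)^3 + m3 ν ∧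
    ∫ x, (kap ν T - min x T)^4 ∂ν ≤ T * ((1/μ)^3 + m3 ν) := by
  have hk0 : 0 < kap ν T := h.kap_pos.trans_le (h.kap_mono hT)
  have hk1 := h.kap_le hT
  have hk2 := h.kap_le_T hT
  set κ := kap ν T with hκ
  have hb : ∀ᵐ x ∂ν, |κ - min x T| ≤ T := by
    filter_upwards [h.supp] with x hx
    have a1 := min_le_right x T
    have a2 : 0 ≤ min x T := le_min hx (by linarith)
    rw [abs_le]; constructor <;> linarith
  have hb3 : ∀ᵐ x ∂ν, |κ - min x T|^3 ≤ (1/μ)^3 + x^3 := by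
    filter_upwards [h.supp] with x hx
    have a1 := min_le_left x T
    have a2 : 0 ≤ min x T := le_min hx (by linarith)
    have hp : 0 ≤ x^3 := pow_nonneg hx 3
    have hq : 0 ≤ (1/μ)^3 := pow_nonneg (by linarith) 3
    rcases le_total (κ - min x T) 0 with hs | hs
    · rw [abs_of_nonpos hs]
      have := pow_le_pow_left₀ (by linarith) (show -(κ - min x T) ≤ x by linarith) 3
      linarith
    · rw [abs_of_nonneg hs]
      have := pow_le_pow_left₀ hs (show (κ - min x T) ≤ 1/μ by linarith) 3
      linarith
  have hI : ∀ n : ℕ, Integrable (fun x => (κ - min x T)^n) ν := by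
    intro n
    refine Integrable.of_bound (by fun_prop) (T^n) ?_
    filter_upwards [hb] with x hx
    rw [norm_pow]
    exact pow_le_pow_left₀ (norm_nonneg _) hx n
  have hI3 : Integrable (fun x => |κ - min x T|^3) ν := by
    have := (hI 3).norm
    simpa [norm_pow] using this
  have hB : ∫ x, |κ - min x T|^3 ∂ν ≤ (1/μ)^3 + m3 ν := by
    have := integral_mono_ae hI3 ((integrable_const ((1/μ)^3)).add h.int3) hb3
    rw [integral_add' (integrable_const _) h.int3] at this
    simpa [m3] using this
  refine ⟨?_, ?_, ?_, ?_⟩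
  · rw [integral_sub (integrable_const _) (h.int_min (by linarith))]
    simp [hκ, kap]
  · have : ∫ x, (κ - min x T)^2 ∂ν ≤ ∫ x, (1 + |κ - min x T|^3) ∂ν := by
      refine integral_mono (hI 2) ((integrable_const _).add hI3) (fun x => ?_)
      simp only
      rw [← sq_abs]
      have := abs_nonneg (κ - min x T)
      rcases le_total (|κ - min x T|) 1 with h1 | h1
      · have : 0 ≤ |κ - min x T|^3 := by positivity
        nlinarith
      · nlinarith [mul_nonneg (sq_nonneg (|κ - min x T|)) (by linarith : 0 ≤ |κ - min x T| - 1)]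
    rw [integral_add (integrable_const _) hI3] at this
    simp at this
    linarith
  · refine (abs_integral_le_integral_abs).trans ?_
    simp only [abs_pow]
    exact hB
  · have : ∫ x, (κ - min x T)^4 ∂ν ≤ ∫ x, (T * |κ - min x T|^3) ∂ν := by
      refine integral_mono_ae (hI 4) (hI3.const_mul T) ?_
      filter_upwards [hb] with x hx
      have : (κ - min x T)^4 = |κ - min x T| * |κ - min x T|^3 := by
        rw [← pow_succ', ← abs_pow, abs_of_nonneg]; norm_num; positivity
      rw [this]
      exact mul_le_mul_of_nonneg_right hx (by positivity)
    rw [integral_const_mul] at this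
    exact this.trans (mul_le_mul_of_nonneg_left hB (by linarith))

lemma Ren.bmH (h : Ren P ν μ η) (r s : ℝ) (i : ℕ) : BM (fun ω => Hf r s i (fun i => η i ω)) := by
  refine ⟨(measurable_Hf r s i).comp (measurable_pi_lambda _ h.meas), 1, fun ω => ?_⟩
  rw [abs_of_nonneg (Hf_nonneg _ _ _ _)]
  exact Hf_le_one _ _ _ _

lemma Ren.bmK (h : Ren P ν μ η) (r s : ℝ) (i : ℕ) : BM (fun ω => Kf r s i (fun i => η i ω)) :=
  BM.sum _ (fun i _ => h.bmH r s i)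

lemma Ren.bmMin (h : Ren P ν μ η) {T : ℝ} (hT : 0 ≤ T) (i : ℕ) : BM (fun ω => min (η i ω) T) := by
  refine ⟨(h.meas i).min measurable_const, T, fun ω => ?_⟩
  rw [abs_of_nonneg (le_min (h.nonneg _ _) hT)]
  exact min_le_right _ _

lemma Ren.bmL (h : Ren P ν μ η) (r s : ℝ) {T : ℝ} (hT : 0 ≤ T) (κ : ℝ) (i : ℕ) :
    BM (fun ω => Lf r s T κ i (fun i => η i ω)) :=
  BM.sum _ (fun i _ => (h.bmH r s i).mul ((BM.const κ).sub (h.bmMin hT (i+1))))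

lemma Ren.L_indep (h : Ren P ν μ η) (r s T κ : ℝ) (m : ℕ) (g : ℝ → ℝ → ℝ → ℝ) (φ : ℝ → ℝ)
    (hg : Measurable (fun q : ℝ × ℝ × ℝ => g q.1 q.2.1 q.2.2)) (hφ : Measurable φ) :
    ∫ ω, g (Kf r s m (fun i => η i ω)) (Lf r s T κ m (fun i => η i ω)) (Hf r s m (fun i => η i ω))
      * φ (η (m+1) ω) ∂P =
    (∫ ω, g (Kf r s m (fun i => η i ω)) (Lf r s T κ m (fun i => η i ω)) (Hf r s m (fun i => η i ω)) ∂P)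
      * ∫ ω, φ (η (m+1) ω) ∂P := by
  have hG : Measurable (fun x : ℕ → ℝ => g (Kf r s m x) (Lf r s T κ m x) (Hf r s m x)) :=
    hg.comp ((measurable_Kf r s m).prodMk ((measurable_Lf r s T κ m).prodMk (measurable_Hf r s m)))
  have hi := indep_dep (S := {i | i ≤ m}) (T := {m+1}) h.indep h.meas (by simp) hG
    (hφ.comp (measurable_pi_apply (m+1)))
    (fun x y hxy => by
      rw [Kf_dep x y hxy, Lf_dep x y hxy, Hf_dep le_rfl x y hxy])
    (fun x y hxy => by
      simp only [Function.comp]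
      rw [hxy (m+1) rfl])
  refine hi.integral_fun_mul_eq_mul_integral ?_ ?_
  · exact (hG.comp (measurable_pi_lambda _ h.meas)).aestronglyMeasurable
  · exact (hφ.comp (h.meas _)).aestronglyMeasurable

lemma Ren.L4 (h : Ren P ν μ η) : ∃ C : ℝ, 0 ≤ C ∧ ∀ T r s : ℝ, 1 ≤ T → s - r ≤ T → ∀ m,
    ∫ ω, (Lf r s T (kap ν T) m (fun i => η i ω))^4 ∂P ≤ C * T^2 := by
  set C3 := (1/μ)^3 + m3 ν with hC3
  set C := 6 * (1 + C3) + 2 * C3 with hC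
  have hC30 : 0 ≤ C3 := by
    have := h.m3_nonneg; have := h.μpos; positivity
  have hC0 : 0 ≤ C := by positivity
  set c := C / kap ν 1 with hc
  have hk1 := h.kap_pos
  have hc0 : 0 ≤ c := by positivity
  refine ⟨4 * ((c^2+2*c)^2 + 2*c + c^2/2 + 1/4), by positivity, fun T r s hT hrs m => ?_⟩
  obtain ⟨d1, d2, d3, d4⟩ := h.dmom hT
  have hT0 : 0 ≤ T := by linarith
  have hk := h.kap_mono hT
  have hkT := h.kap_le_T hT
  set κ := kap ν T with hκ
  have main : ∀ m, ∫ ω, ((Lf r s T κ m (fun i => η i ω))^4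
      - C * Kf r s m (fun i => η i ω) * (Lf r s T κ m (fun i => η i ω))^2
      - C * T * Kf r s m (fun i => η i ω)) ∂P ≤ 0 := by
    intro m
    induction m with
    | zero => simp [Lf, Kf]
    | succ m ih =>
      refine le_trans ?_ ih
      have := step_ineq (P := P) (K := fun ω => Kf r s m (fun i => η i ω))
        (L := fun ω => Lf r s T κ m (fun i => η i ω)) (H := fun ω => Hf r s m (fun i => η i ω))
        (D := fun ω => κ - min (η (m+1) ω) T) (C3 := C3) (C := C) (T := T)
        (h.bmK r s m) (h.bmL r s hT0 κ m) (h.bmH r s m) ((BM.const κ).sub (h.bmMin hT0 (m+1)))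
        (fun ω => Finset.sum_nonneg (fun i _ => Hf_nonneg _ _ _ _))
        (fun ω => Hf_nonneg _ _ _ _) (fun ω => Hf_sq _ _ _ _)
        (fun g φ hg hφ => h.L_indep r s T κ m g (fun y => φ (κ - min y T)) hg (by fun_prop))
        ((h.integral m (f := fun y => κ - min y T) (by fun_prop)).trans d1)
        ((h.integral m (f := fun y => (κ - min y T)^2) (by fun_prop)).trans_le d2)
        (by rw [h.integral m (f := fun y => (κ - min y T)^3) (by fun_prop)]; exact d3)
        ((h.integral m (f := fun y => (κ - min y T)^4) (by fun_prop)).trans_le d4) hT rfl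
      refine le_trans (le_of_eq ?_) this
      refine integral_congr_ae (Eventually.of_forall fun ω => ?_)
      simp only [Lf, Kf, Finset.sum_range_succ]
  have hL := h.bmL r s hT0 κ m
  have hK := h.bmK r s m
  have h2 : ∀ ω, C * Kf r s m (fun i => η i ω) * (Lf r s T κ m (fun i => η i ω))^2
      + C * T * Kf r s m (fun i => η i ω) ≤ 3/4 * (Lf r s T κ m (fun i => η i ω))^4
        + ((c^2+2*c)^2 + 2*c + c^2/2 + 1/4) * T^2 := by
    intro ω
    refine L4_arith hk1 hc hC0 hT ?_
    have e := kap_K r s T κ m (fun i => η i ω)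
    have w := (Wf_le m (fun i => h.nonneg i ω) hT0 hrs).2
    have k0 : 0 ≤ Kf r s m (fun i => η i ω) := Finset.sum_nonneg (fun i _ => Hf_nonneg _ _ _ _)
    have := mul_le_mul_of_nonneg_right hk k0
    have := le_abs_self (Lf r s T κ m (fun i => η i ω))
    linarith
  have h3 := main m
  have bKL := ((hK.cmul C).mul (hL.pow 2)).add (hK.cmul (C*T))
  have e3 : ∫ ω, (Lf r s T κ m (fun i => η i ω))^4 ∂P ≤
      ∫ ω, (C * Kf r s m (fun i => η i ω) * (Lf r s T κ m (fun i => η i ω))^2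
      + C * T * Kf r s m (fun i => η i ω)) ∂P := by
    rw [← sub_nonpos, ← integral_sub (hL.pow 4).int bKL.int]
    refine le_trans (le_of_eq ?_) h3
    congr 1; ext ω; ring
  have e4 := integral_mono (μ := P) bKL.int (((hL.pow 4).cmul (3/4)).add (BM.const _)).int h2
  rw [integral_add ((hL.pow 4).cmul (3/4)).int (BM.const _).int, integral_const_mul] at e4
  simp at e4
  linarith

end
end RenAux

namespace RenAux
open scoped ENNReal NNReal
section
variable {Ω : Type*} [MeasurableSpace Ω] {P : Measure Ω} [IsProbabilityMeasure P]
  {ν : Measure ℝ} [IsProbabilityMeasure ν] {μ : ℝ} {η : ℕ → Ω → ℝ}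

noncomputable def Gf (q : ℝ × ℝ) : ℝ≥0∞ :=
  ({q : ℝ × ℝ | 0 ≤ q.1 ∧ q.1 < q.2}).indicator (fun q => ENNReal.ofReal (q.2^2)) q

lemma measurable_Gf : Measurable Gf := by
  refine Measurable.indicator (by fun_prop) ?_
  exact (measurableSet_le measurable_const measurable_fst).inter
    (measurableSet_lt measurable_fst measurable_snd)

lemma Gf_of {t y : ℝ} (h0 : 0 ≤ t) (h1 : t < y) : Gf (t, y) = ENNReal.ofReal (y^2) :=
  indicator_of_mem (show (t,y) ∈ {q : ℝ × ℝ | 0 ≤ q.1 ∧ q.1 < q.2} from ⟨h0, h1⟩) _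

lemma Ren.dbl (h : Ren P ν μ η) : ∫⁻ t : ℝ, ∫⁻ y, Gf (t, y) ∂ν = ENNReal.ofReal (m3 ν) := by
  rw [lintegral_lintegral_swap (f := fun t y => Gf (t, y)) measurable_Gf.aemeasurable, m3,
    ofReal_integral_eq_lintegral_ofReal h.int3 (by
      filter_upwards [h.supp] with x hx; exact pow_nonneg hx 3)]
  refine lintegral_congr_ae ?_
  filter_upwards [h.supp] with y hy
  have : (fun t : ℝ => Gf (t, y)) = (Ico 0 y).indicator (fun _ => ENNReal.ofReal (y^2)) := by
    ext t
    unfold Gf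
    by_cases ht : 0 ≤ t ∧ t < y
    · rw [indicator_of_mem (by exact ht), indicator_of_mem (by exact ht)]
    · rw [indicator_of_notMem (by exact ht), indicator_of_notMem (by exact ht)]
  rw [this, lintegral_indicator measurableSet_Ico, setLIntegral_const, Real.volume_Ico,
    ← ENNReal.ofReal_mul (by positivity)]
  congr 1; ring

lemma min4_le {t T y : ℝ} (ht : 0 ≤ t) (hT : 0 ≤ T) (hy : t ≤ y) : (min t T)^4 ≤ T^2 * y^2 := by
  have h0 : 0 ≤ min t T := le_min ht hT
  have h1 : (min t T)^2 ≤ T^2 := pow_le_pow_left₀ h0 (min_le_right _ _) 2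
  have h2 : (min t T)^2 ≤ y^2 := pow_le_pow_left₀ h0 ((min_le_left _ _).trans hy) 2
  calc (min t T)^4 = (min t T)^2 * (min t T)^2 := by ring
    _ ≤ _ := mul_le_mul h1 h2 (by positivity) (by positivity)

lemma Ren.R0 (h : Ren P ν μ η) {T : ℝ} (hT : 0 ≤ T) :
    ∫⁻ ω, ENNReal.ofReal ((min (η 0 ω) T)^4) ∂P ≤ ENNReal.ofReal (T^2 * (μ * m3 ν)) := by
  have hν := measurable_nuIoi (ν := ν)
  have hd : Measurable (fun t => ENNReal.ofReal μ * (Ici (0:ℝ)).indicator (fun u => ν (Ioi u)) t) :=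
    (hν.indicator measurableSet_Ici).const_mul _
  have e : ∫⁻ ω, ENNReal.ofReal ((min (η 0 ω) T)^4) ∂P
      = ∫⁻ t, ENNReal.ofReal ((min t T)^4) ∂(Measure.map (η 0) P) := by
    rw [lintegral_map (by fun_prop) (h.meas 0)]
  rw [e, h.law0, lintegral_withDensity_eq_lintegral_mul _ hd (by fun_prop),
    ENNReal.ofReal_mul (by positivity), ENNReal.ofReal_mul h.μpos.le, ← h.dbl,
    ← mul_assoc, ← lintegral_const_mul _ measurable_Gf.lintegral_prod_right']
  refine lintegral_mono (fun t => ?_)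
  simp only [Pi.mul_apply]
  by_cases ht : 0 ≤ t
  · rw [indicator_of_mem (by exact ht)]
    have : ENNReal.ofReal ((min t T)^4) * ν (Ioi t) ≤ ENNReal.ofReal (T^2) * ∫⁻ y, Gf (t, y) ∂ν := by
      rw [← lintegral_indicator_one measurableSet_Ioi,
        ← lintegral_const_mul _ (measurable_one.indicator measurableSet_Ioi),
        ← lintegral_const_mul _ (show Measurable (fun y => Gf (t, y)) from measurable_Gf.comp measurable_prodMk_left)]
      refine lintegral_mono (fun y => ?_)
      by_cases hy : t < y
      · rw [indicator_of_mem (by exact hy), Gf_of ht hy, Pi.one_apply, mul_one,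
          ← ENNReal.ofReal_mul (by positivity)]
        exact ENNReal.ofReal_le_ofReal (min4_le ht hT hy.le)
      · rw [indicator_of_notMem (by exact hy)]; simp
    calc _ = ENNReal.ofReal μ * (ENNReal.ofReal ((min t T)^4) * ν (Ioi t)) := by ring
      _ ≤ _ := mul_le_mul_right this _
      _ = _ := by ring
  · rw [indicator_of_notMem (by exact ht)]; simp

lemma Ren.R1 (h : Ren P ν μ η) {r T : ℝ} (hT : 0 ≤ T) :
    ∑' i, ∫⁻ ω, ENNReal.ofReal (Rt r T i (fun i => η i ω)) ∂P ≤ ENNReal.ofReal (T^2 * (μ * m3 ν)) := by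
  set f : ℝ → ℝ≥0∞ := fun u => ∫⁻ y, Gf (r - u, y) ∂ν with hf
  have hGr : Measurable (fun q : ℝ × ℝ => Gf (r - q.1, q.2)) := measurable_Gf.comp (by fun_prop)
  have hfm : Measurable f := hGr.lintegral_prod_right'
  have h1 : ∀ i, ∫⁻ ω, ENNReal.ofReal (Rt r T i (fun i => η i ω)) ∂P
      ≤ ENNReal.ofReal (T^2) * ∫⁻ ω, f (ps (fun i => η i ω) (i+1)) ∂P := by
    intro i
    have := lint_indep (h.meas_ps (i+1)) (h.meas (i+1)) (h.indep_ps (i+1))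
      (g := fun u y => Gf (r - u, y)) hGr
    rw [h.law i] at this
    rw [hf, ← this, ← lintegral_const_mul _ (show Measurable (fun ω => Gf (r - ps (fun i => η i ω) (i+1), η (i+1) ω)) from hGr.comp ((h.meas_ps (i+1)).prodMk (h.meas (i+1))))]
    refine lintegral_mono (fun ω => ?_)
    have ep : ps (fun i => η i ω) (i+2) = ps (fun i => η i ω) (i+1) + η (i+1) ω := ps_succ _ _
    simp only [Rt]
    split_ifs with hh
    · rw [ep] at hh
      rw [Gf_of (by linarith [hh.1]) (by linarith [hh.2]), ← ENNReal.ofReal_mul (by positivity), ep]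
      refine ENNReal.ofReal_le_ofReal (min4_le (by linarith [hh.2]) hT (by linarith [hh.1]))
    · simp
  calc _ ≤ ∑' i, ENNReal.ofReal (T^2) * ∫⁻ ω, f (ps (fun i => η i ω) (i+1)) ∂P := ENNReal.tsum_le_tsum h1
    _ = ENNReal.ofReal (T^2) * (ENNReal.ofReal μ * ∫⁻ u in Ici (0:ℝ), f u) := by
      rw [ENNReal.tsum_mul_left, h.palm hfm]
    _ ≤ ENNReal.ofReal (T^2) * (ENNReal.ofReal μ * ∫⁻ u, f u) := by
      gcongr; exact Measure.restrict_le_self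
    _ = _ := by
      rw [hf, lintegral_sub_left_eq_self (fun u => ∫⁻ y, Gf (u, y) ∂ν) r, h.dbl,
        ← ENNReal.ofReal_mul h.μpos.le, ← ENNReal.ofReal_mul (by positivity)]

lemma Ren.R (h : Ren P ν μ η) {r T : ℝ} (hT : 0 ≤ T) (m : ℕ) :
    ∫⁻ ω, ENNReal.ofReal (Rf r T m (fun i => η i ω)) ∂P ≤ ENNReal.ofReal (T^2 * (2 * μ * m3 ν)) := by
  have hpi : Measurable (fun ω (i : ℕ) => η i ω) := measurable_pi_lambda _ h.meas
  have e : ∀ ω, ENNReal.ofReal (Rf r T m (fun i => η i ω)) = ENNReal.ofReal ((min (η 0 ω) T)^4)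
      + ∑ i ∈ Finset.range m, ENNReal.ofReal (Rt r T i (fun i => η i ω)) := by
    intro ω
    unfold Rf
    rw [ENNReal.ofReal_add (by positivity) (Finset.sum_nonneg (fun i _ => Rt_nonneg i)),
      ENNReal.ofReal_sum_of_nonneg (fun i _ => Rt_nonneg i)]
  simp_rw [e]
  rw [lintegral_add_left (by have := h.meas 0; fun_prop), lintegral_finsetSum _ (fun i _ =>
    show Measurable (fun ω => ENNReal.ofReal (Rt r T i (fun i => η i ω))) from
      ((measurable_Rt r T i).comp hpi).ennreal_ofReal)]
  have h1 := h.R0 hT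
  have h2 := (ENNReal.sum_le_tsum (Finset.range m)).trans (h.R1 (r := r) hT)
  have h3 := h.m3_nonneg
  have h4 := h.μpos
  calc _ ≤ _ := add_le_add h1 h2
    _ = _ := by
      rw [← ENNReal.ofReal_add (by positivity) (by positivity)]; congr 1; ring

lemma Ren.EK (h : Ren P ν μ η) {r s : ℝ} (hr : 0 ≤ r) (hrs : r ≤ s) (m : ℕ) :
    ∫ ω, Kf r s m (fun i => η i ω) ∂P ≤ μ * (s - r) := by
  have hm := h.μpos
  rw [← ENNReal.ofReal_le_ofReal_iff (mul_nonneg hm.le (by linarith)),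
    ofReal_integral_eq_lintegral_ofReal (h.bmK r s m).int
    (Eventually.of_forall fun ω => Finset.sum_nonneg (fun i _ => Hf_nonneg _ _ _ _)), ← h.palm_Ioc hr]
  have hpi : Measurable (fun ω (i : ℕ) => η i ω) := measurable_pi_lambda _ h.meas
  have e : ∀ ω, ENNReal.ofReal (Kf r s m (fun i => η i ω)) = ∑ i ∈ Finset.range m,
      ENNReal.ofReal (Hf r s i (fun i => η i ω)) := fun ω =>
    ENNReal.ofReal_sum_of_nonneg (fun i _ => Hf_nonneg _ _ _ _)
  simp_rw [e]
  rw [lintegral_finsetSum _ (fun i _ => show Measurable (fun ω => ENNReal.ofReal (Hf r s i (fun i => η i ω))) from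
    ((measurable_Hf r s i).comp hpi).ennreal_ofReal)]
  refine le_trans (Finset.sum_le_sum (fun i _ => ?_)) (ENNReal.sum_le_tsum (Finset.range m))
  rw [← lintegral_indicator_one (show MeasurableSet {ω | ps (fun i => η i ω) (i+1) ∈ Ioc r s} from
    (h.meas_ps (i+1)) measurableSet_Ioc)]
  refine lintegral_mono (fun ω => ?_)
  by_cases hh : ps (fun i => η i ω) (i+1) ∈ Ioc r s
  · rw [Hf_one hh, indicator_of_mem (by exact hh)]; simp
  · rw [Hf_zero hh]; simp

lemma Ren.E4 (h : Ren P ν μ η) {T r s : ℝ} (hT : 1 ≤ T) (hr : 0 ≤ r) (hrs : r ≤ s) (hrsT : s - r ≤ T) (m : ℕ) :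
    ∫ ω, Ef r s T m (fun i => η i ω) ∂P ≤ T^2 * (μ * m3 ν) := by
  have hT0 : 0 ≤ T := by linarith
  have hm := h.μpos
  have h3 := h.m3_nonneg
  set q := ∫ y, (min y T)^4 ∂ν with hq
  have hq1 : q ≤ T * m3 ν := by
    rw [hq, m3, ← integral_const_mul]
    refine integral_mono_of_nonneg (Eventually.of_forall fun y => by positivity) (h.int3.const_mul T) ?_
    filter_upwards [h.supp] with y hy
    have h0 : 0 ≤ min y T := le_min hy hT0
    have h2 := pow_le_pow_left₀ h0 (min_le_left y T) 3
    calc (min y T)^4 = min y T * (min y T)^3 := by ring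
      _ ≤ _ := mul_le_mul (min_le_right _ _) h2 (by positivity) hT0
  have e : ∫ ω, Ef r s T m (fun i => η i ω) ∂P = (∫ ω, Kf r s m (fun i => η i ω) ∂P) * q := by
    unfold Ef Kf
    rw [integral_finsetSum _ (fun i _ => ((h.bmH r s i).mul ((h.bmMin hT0 (i+1)).pow 4)).int),
      integral_finsetSum _ (fun i _ => (h.bmH r s i).int), Finset.sum_mul]
    refine Finset.sum_congr rfl (fun i _ => ?_)
    rw [h.L_indep r s T 0 i (fun k l h => h) (fun y => (min y T)^4) (by fun_prop) (by fun_prop),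
      h.integral i (f := fun y => (min y T)^4) (by fun_prop)]
  rw [e]
  have hq0 : 0 ≤ q := integral_nonneg (fun y => by positivity)
  calc _ ≤ (μ * T) * (T * m3 ν) := by
        refine mul_le_mul ((h.EK hr hrs m).trans ?_) hq1 hq0 (by positivity)
        exact mul_le_mul_of_nonneg_left hrsT hm.le
    _ = _ := by ring

lemma four_add (x y : ℝ) : (x + y)^4 ≤ 8 * x^4 + 8 * y^4 := by
  nlinarith [sq_nonneg (x - y), sq_nonneg (x + y), sq_nonneg (x^2 - y^2), sq_nonneg (x*y),
    mul_nonneg (sq_nonneg (x-y)) (sq_nonneg (x+y)), sq_nonneg ((x-y)^2), mul_nonneg (sq_nonneg (x-y)) (add_nonneg (sq_nonneg x) (sq_nonneg y))]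

lemma Ren.cntk4 (h : Ren P ν μ η) : ∃ C : ℝ, 0 ≤ C ∧ ∀ T r s : ℝ, 1 ≤ T → 0 ≤ r → r ≤ s → s - r ≤ T →
    ∫⁻ ω, ENNReal.ofReal ((kap ν T * (cnt (fun i => η i ω) r s).toReal - (s - r))^4) ∂P
      ≤ ENNReal.ofReal (C * T^2) := by
  obtain ⟨C, hC, hL⟩ := h.L4
  have hm := h.μpos
  have h3 := h.m3_nonneg
  have hpi : Measurable (fun ω (i : ℕ) => η i ω) := measurable_pi_lambda _ h.meas
  refine ⟨8 * C + 8 * (2 * μ * m3 ν) + 8 * (μ * m3 ν), by positivity, fun T r s hT hr hrs hrsT => ?_⟩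
  have hT0 : 0 ≤ T := by linarith
  set κ := kap ν T with hκ
  set f : Ω → ℝ≥0∞ := fun ω => ENNReal.ofReal ((κ * (cnt (fun i => η i ω) r s).toReal - (s - r))^4) with hf
  have hfm : Measurable f := by
    have := (measurable_cnt r s).comp hpi
    have : Measurable (fun ω => cnt (fun i => η i ω) r s) := this
    fun_prop
  set E : ℕ → Set Ω := fun m => {ω | s < ps (fun i => η i ω) (m+1)} with hE
  have hEm : ∀ m, MeasurableSet (E m) := fun m => measurableSet_lt measurable_const (h.meas_ps (m+1))
  have hb : ∀ m, ∫⁻ ω, (E m).indicator f ω ∂P ≤ ENNReal.ofReal ((8 * C + 8 * (2 * μ * m3 ν) + 8 * (μ * m3 ν)) * T^2) := by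
    intro m
    have p : ∀ ω, (E m).indicator f ω ≤ (ENNReal.ofReal (8 * (Lf r s T κ m (fun i => η i ω))^4)
        + ENNReal.ofReal (8 * Ef r s T m (fun i => η i ω))) + 8 * ENNReal.ofReal (Rf r T m (fun i => η i ω)) := by
      intro ω
      by_cases hω : ω ∈ E m
      · rw [indicator_of_mem hω]
        have hr0 := Rf_nonneg (r := r) (T := T) m (x := fun i => η i ω)
        have he0 := Ef_nonneg (r := r) (s := s) (T := T) m (x := fun i => η i ω)
        have e8 : (8:ℝ≥0∞) = ENNReal.ofReal 8 := by norm_num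
        rw [e8, ← ENNReal.ofReal_mul (by norm_num), ← ENNReal.ofReal_add (by positivity) (by positivity),
          ← ENNReal.ofReal_add (by positivity) (by positivity)]
        refine ENNReal.ofReal_le_ofReal ?_
        rw [Kf_cnt (h.ps_mono ω) hω, kap_K]
        have := (W_dev m (fun i => h.nonneg i ω) hT0 hr hrs hrsT).2.2 hω
        have h8 := four_add (Lf r s T κ m (fun i => η i ω)) (Wf r s T m (fun i => η i ω) - (s - r))
        rw [add_sub_assoc]
        linarith
      · rw [indicator_of_notMem hω]; exact zero_le
    refine (lintegral_mono p).trans ?_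
    have mL : Measurable (fun ω => (Lf r s T κ m (fun i => η i ω))) := (measurable_Lf r s T κ m).comp hpi
    have mE : Measurable (fun ω => (Ef r s T m (fun i => η i ω))) := (measurable_Ef r s T m).comp hpi
    rw [lintegral_add_left (by fun_prop), lintegral_add_left (by fun_prop), lintegral_const_mul']
    swap
    · norm_num
    have bE : BM (fun ω => Ef r s T m (fun i => η i ω)) := 
      BM.sum _ (fun i _ => (h.bmH r s i).mul ((h.bmMin hT0 (i+1)).pow 4))
    have q1 : ∫⁻ ω, ENNReal.ofReal (8 * (Lf r s T κ m (fun i => η i ω))^4) ∂P ≤ ENNReal.ofReal (8 * (C * T^2)) := by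
      rw [← ofReal_integral_eq_lintegral_ofReal (((h.bmL r s hT0 κ m).pow 4).cmul 8).int
        (Eventually.of_forall fun ω => by simp only [Pi.zero_apply]; positivity), integral_const_mul]
      exact ENNReal.ofReal_le_ofReal (mul_le_mul_of_nonneg_left (hL T r s hT hrsT m) (by norm_num))
    have q2 : ∫⁻ ω, ENNReal.ofReal (8 * Ef r s T m (fun i => η i ω)) ∂P ≤ ENNReal.ofReal (8 * (T^2 * (μ * m3 ν))) := by
      rw [← ofReal_integral_eq_lintegral_ofReal (bE.cmul 8).int
        (Eventually.of_forall fun ω => mul_nonneg (by norm_num) (Ef_nonneg m)), integral_const_mul]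
      exact ENNReal.ofReal_le_ofReal (mul_le_mul_of_nonneg_left (h.E4 hT hr hrs hrsT m) (by norm_num))
    have q3 : 8 * ∫⁻ ω, ENNReal.ofReal (Rf r T m (fun i => η i ω)) ∂P ≤ ENNReal.ofReal (8 * (T^2 * (2 * μ * m3 ν))) := by
      have e8 : (8:ℝ≥0∞) = ENNReal.ofReal 8 := by norm_num
      rw [ENNReal.ofReal_mul (by norm_num), ← e8]
      exact mul_le_mul_right (h.R hT0 m) _
    refine (add_le_add (add_le_add q1 q2) q3).trans (le_of_eq ?_)
    rw [← ENNReal.ofReal_add (by positivity) (by positivity), ← ENNReal.ofReal_add (by positivity) (by positivity)]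
    congr 1; ring
  have hmono : Monotone (fun m => (E m).indicator f) := by
    intro m n hmn ω
    refine indicator_le_indicator_of_subset (fun ω hω => ?_) (fun _ => zero_le) ω
    exact lt_of_lt_of_le hω (h.ps_mono ω (by omega))
  have e : ∫⁻ ω, f ω ∂P ≤ ∫⁻ ω, ⨆ m, (E m).indicator f ω ∂P := by
    refine lintegral_mono_ae ?_
    filter_upwards [h.diverge'] with ω hω
    obtain ⟨m, hm⟩ := hω s
    refine le_trans (le_of_eq ?_) (le_iSup (fun m => (E m).indicator f ω) m)
    rw [indicator_of_mem (by exact hm)]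
  refine e.trans ?_
  rw [lintegral_iSup (fun m => hfm.indicator (hEm m)) hmono]
  exact iSup_le hb

lemma Ren.cnt4 (h : Ren P ν μ η) : ∃ C : ℝ, 0 ≤ C ∧ ∀ T r s : ℝ, 1 ≤ T → 0 ≤ r → r ≤ s → s - r ≤ T →
    ∫⁻ ω, ENNReal.ofReal (((cnt (fun i => η i ω) r s).toReal - μ * (s - r))^4) ∂P
      ≤ ENNReal.ofReal (C * T^2) := by
  obtain ⟨C, hC, hL⟩ := h.cntk4
  have hm := h.μpos
  have hk1 := h.kap_pos
  set b := μ * (∫ x, x^2 ∂ν) / kap ν 1 with hb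
  have hm2 : 0 ≤ ∫ x, x^2 ∂ν := integral_nonneg (fun x => sq_nonneg x)
  have hb0 : 0 ≤ b := by positivity
  refine ⟨8 / (kap ν 1)^4 * C + 8 * b^4, by positivity, fun T r s hT hr hrs hrsT => ?_⟩
  have hk := h.kap_mono hT
  have hgap := h.kap_gap hT
  have hle := h.kap_le hT
  have hL := hL T r s hT hr hrs hrsT
  set κ := kap ν T
  have hκ : 0 < κ := by linarith
  have p : ∀ N : ℝ, (N - μ * (s-r))^4 ≤ 8 / (kap ν 1)^4 * (κ * N - (s - r))^4 + 8 * b^4 * T^2 := by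
    intro N
    have e : N - μ * (s - r) = (κ * N - (s-r))/κ + (s-r)*(1/κ - μ) := by field_simp; ring
    have h8 := four_add ((κ * N - (s-r))/κ) ((s-r)*(1/κ - μ))
    rw [← e] at h8
    have c1 : ((κ * N - (s-r))/κ)^4 ≤ (κ * N - (s-r))^4 / (kap ν 1)^4 := by
      rw [div_pow]
      exact div_le_div_of_nonneg_left (by positivity) (by positivity) (pow_le_pow_left₀ hk1.le hk 4)
    have c0 : 1/κ - μ = μ * (1/μ - κ) / κ := by field_simp
    have c2 : 0 ≤ 1/κ - μ := by
      rw [c0]; exact div_nonneg (mul_nonneg hm.le (by linarith)) hκ.le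
    have c3 : (s-r)*(1/κ - μ) ≤ b := by
      rw [c0, hb]
      have : (s-r) * (1/μ - κ) ≤ ∫ x, x^2 ∂ν := by
        calc (s-r) * (1/μ - κ) ≤ T * ((∫ x, x^2 ∂ν) / T) := by
              refine mul_le_mul hrsT hgap (by linarith) (by linarith)
          _ = _ := by field_simp
      calc (s-r) * (μ * (1/μ - κ) / κ) = μ * ((s-r) * (1/μ - κ)) / κ := by ring
        _ ≤ μ * (∫ x, x^2 ∂ν) / κ := by gcongr
        _ ≤ _ := by gcongr
    have c4 : ((s-r)*(1/κ - μ))^4 ≤ b^4 :=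
      pow_le_pow_left₀ (mul_nonneg (by linarith) c2) c3 4
    have c5 : b^4 ≤ b^4 * T^2 := le_mul_of_one_le_right (by positivity) (by nlinarith)
    calc _ ≤ _ := h8
      _ ≤ 8 * ((κ * N - (s-r))^4 / (kap ν 1)^4) + 8 * (b^4 * T^2) := by linarith
      _ = _ := by ring
  refine (lintegral_mono (fun ω => ENNReal.ofReal_le_ofReal (p _))).trans ?_
  have e : ∀ ω, ENNReal.ofReal (8 / (kap ν 1)^4 * (κ * (cnt (fun i => η i ω) r s).toReal - (s - r))^4 + 8 * b^4 * T^2)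
      = ENNReal.ofReal (8 / (kap ν 1)^4) * ENNReal.ofReal ((κ * (cnt (fun i => η i ω) r s).toReal - (s - r))^4) + ENNReal.ofReal (8 * b^4 * T^2) := by
    intro ω
    rw [ENNReal.ofReal_add (by positivity) (by positivity), ENNReal.ofReal_mul (by positivity)]
  simp_rw [e]
  rw [lintegral_add_right _ measurable_const, lintegral_const_mul' _ _ ENNReal.ofReal_ne_top]
  simp only [lintegral_const, measure_univ, mul_one]
  refine (add_le_add_left (mul_le_mul_right hL _) _).trans (le_of_eq ?_)
  rw [← ENNReal.ofReal_mul (by positivity), ← ENNReal.ofReal_add (by positivity) (by positivity)]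
  congr 1; ring

end
end RenAux

namespace RenAux
open scoped ENNReal NNReal
section
variable {Ω : Type*} [MeasurableSpace Ω] {P : Measure Ω} [IsProbabilityMeasure P]
  {ν : Measure ℝ} [IsProbabilityMeasure ν] {μ : ℝ} {η : ℕ → Ω → ℝ}

noncomputable def Xf (μ r s : ℝ) (x : ℕ → ℝ) : ℝ := (cnt x r s).toReal - μ * (s - r)

lemma measurable_Xf (μ r s : ℝ) : Measurable (Xf μ r s) := by
  have := measurable_cnt r s
  unfold Xf; fun_prop

lemma int_of_lint {f : Ω → ℝ} (hf : Measurable f) (h0 : ∀ ω, 0 ≤ f ω) {B : ℝ} (hB : 0 ≤ B)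
    (h : ∫⁻ ω, ENNReal.ofReal (f ω) ∂P ≤ ENNReal.ofReal B) : Integrable f P ∧ ∫ ω, f ω ∂P ≤ B := by
  refine ⟨⟨hf.aestronglyMeasurable, ?_⟩, ?_⟩
  · rw [hasFiniteIntegral_iff_ofReal (Eventually.of_forall h0)]
    exact h.trans_lt ENNReal.ofReal_lt_top
  · rw [integral_eq_lintegral_of_nonneg_ae (Eventually.of_forall h0) hf.aestronglyMeasurable]
    exact ENNReal.toReal_le_of_le_ofReal hB h

lemma Ren.meas_X (h : Ren P ν μ η) (r s : ℝ) : Measurable (fun ω => Xf μ r s (fun i => η i ω)) :=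
  (measurable_Xf μ r s).comp (measurable_pi_lambda _ h.meas)

lemma Ren.X4 (h : Ren P ν μ η) {r s : ℝ} (hr : 0 ≤ r) (hrs : r ≤ s) :
    Integrable (fun ω => Xf μ r s (fun i => η i ω) ^ 4) P := by
  obtain ⟨C, hC, hc⟩ := h.cnt4
  exact (int_of_lint ((h.meas_X r s).pow_const 4) (fun ω => by positivity) (by positivity)
    (hc (max 1 (s - r)) r s (le_max_left _ _) hr hrs (le_max_right _ _))).1

lemma Ren.X_mean (h : Ren P ν μ η) {r s : ℝ} (hr : 0 ≤ r) (hrs : r ≤ s) :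
    ∫ ω, Xf μ r s (fun i => η i ω) ∂P = 0 := by
  have hpi : Measurable (fun ω (i : ℕ) => η i ω) := measurable_pi_lambda _ h.meas
  have hm : Measurable (fun ω => cnt (fun i => η i ω) r s) := (measurable_cnt r s).comp hpi
  have e : ∫⁻ ω, cnt (fun i => η i ω) r s ∂P = ENNReal.ofReal (μ * (s - r)) := by
    unfold cnt
    rw [lintegral_tsum (fun k => (show Measurable (fun ω => (Ioc r s).indicator (1 : ℝ → ℝ≥0∞) (ps (fun i => η i ω) (k+1))) from
      (measurable_one.indicator measurableSet_Ioc).comp (h.meas_ps (k+1))).aemeasurable), ← h.palm_Ioc hr]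
    congr 1; ext k
    exact lintegral_indicator_one ((h.meas_ps (k+1)) measurableSet_Ioc)
  have hfin : ∀ᵐ ω ∂P, cnt (fun i => η i ω) r s < ∞ :=
    ae_lt_top hm (by rw [e]; exact ENNReal.ofReal_ne_top)
  unfold Xf
  rw [integral_sub (integrable_toReal_of_lintegral_ne_top hm.aemeasurable (by rw [e]; exact ENNReal.ofReal_ne_top))
    (integrable_const _), integral_toReal hm.aemeasurable hfin, e,
    ENNReal.toReal_ofReal (mul_nonneg h.μpos.le (by linarith))]
  simp

lemma Ren.X2 (h : Ren P ν μ η) : ∃ C : ℝ, 0 ≤ C ∧ ∀ r s : ℝ, 0 ≤ r → r ≤ s →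
    ∫ ω, Xf μ r s (fun i => η i ω) ^ 2 ∂P ≤ C * (s - r) := by
  obtain ⟨C, hC, hc⟩ := h.cnt4
  obtain ⟨D, hD, hd⟩ := h.cnt_sq
  have hm := h.μpos
  refine ⟨1 + C + 2 * D + 2 * μ^2, by positivity, fun r s hr hrs => ?_⟩
  rcases le_total 1 (s - r) with hT | hT
  · have h4 := (int_of_lint ((h.meas_X r s).pow_const 4) (fun ω => by positivity) (by positivity)
      (hc (s - r) r s hT hr hrs le_rfl))
    set T := s - r with hTd
    have hT0 : 0 < T := by linarith
    have p : ∀ ω, Xf μ r s (fun i => η i ω) ^ 2 ≤ T + T⁻¹ * Xf μ r s (fun i => η i ω) ^ 4 := by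
      intro ω
      set X := Xf μ r s (fun i => η i ω)
      have : X^2 * T ≤ (T + T⁻¹ * X^4) * T := by
        have : (T + T⁻¹ * X^4) * T = T^2 + X^4 := by field_simp
        rw [this]; nlinarith [sq_nonneg (X^2 - T), sq_nonneg (X^2), sq_nonneg T]
      exact le_of_mul_le_mul_right this hT0
    have := integral_mono_of_nonneg (Eventually.of_forall fun ω => sq_nonneg _)
      ((integrable_const T).add (h4.1.const_mul T⁻¹)) (Eventually.of_forall p)
    rw [integral_add' (integrable_const T) (h4.1.const_mul T⁻¹), integral_const_mul] at this
    simp only [integral_const, probReal_univ, one_smul] at this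
    have h5 : T⁻¹ * ∫ ω, Xf μ r s (fun i => η i ω) ^ 4 ∂P ≤ C * T := by
      rw [inv_mul_le_iff₀ hT0]
      refine h4.2.trans (le_of_eq (by ring))
    nlinarith [mul_nonneg hD hT0.le, mul_nonneg (sq_nonneg μ) hT0.le]
  · have hs := hd r s hr hrs (by linarith)
    have : ∫⁻ ω, ENNReal.ofReal (Xf μ r s (fun i => η i ω) ^ 2) ∂P
        ≤ ENNReal.ofReal ((1 + C + 2 * D + 2 * μ^2) * (s-r)) := by
      have p : ∀ ω, ENNReal.ofReal (Xf μ r s (fun i => η i ω) ^ 2) ≤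
          2 * cnt (fun i => η i ω) r s ^ 2 + ENNReal.ofReal (2 * μ^2 * (s-r)) := by
        intro ω
        unfold Xf
        set c := cnt (fun i => η i ω) r s
        have e2 : 2 * ENNReal.ofReal (c.toReal ^ 2) ≤ 2 * c^2 := by
          gcongr
          rw [ENNReal.ofReal_pow ENNReal.toReal_nonneg]
          gcongr
          exact ENNReal.ofReal_toReal_le
        refine le_trans ?_ (add_le_add_left e2 _)
        rw [show (2:ℝ≥0∞) = ENNReal.ofReal 2 by norm_num, ← ENNReal.ofReal_mul (by norm_num),
          ← ENNReal.ofReal_add (by positivity) (mul_nonneg (by positivity) (by linarith))]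
        refine ENNReal.ofReal_le_ofReal ?_
        nlinarith [sq_nonneg (c.toReal + μ * (s-r)), mul_nonneg (sq_nonneg μ) (mul_nonneg (by linarith : 0 ≤ s - r) (by linarith : 0 ≤ 1 - (s-r)))]
      refine (lintegral_mono p).trans ?_
      rw [lintegral_add_right _ measurable_const, lintegral_const_mul' _ _ (by norm_num)]
      simp only [lintegral_const, measure_univ, mul_one]
      refine (add_le_add_left (mul_le_mul_right hs 2) _).trans ?_
      rw [show (2:ℝ≥0∞) = ENNReal.ofReal 2 by norm_num, ← ENNReal.ofReal_mul (by norm_num),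
          ← ENNReal.ofReal_add (mul_nonneg (by norm_num) (mul_nonneg hD (by linarith))) (mul_nonneg (by positivity) (by linarith))]
      refine ENNReal.ofReal_le_ofReal ?_
      nlinarith [mul_nonneg hC (by linarith : 0 ≤ s - r)]
    exact (int_of_lint ((h.meas_X r s).pow_const 2) (fun ω => by positivity)
      (mul_nonneg (by positivity) (by linarith)) this).2

lemma Ren.X2Y2 (h : Ren P ν μ η) {C0 : ℝ} (hC0 : 0 ≤ C0)
    (hCν : ∀ T, 0 < T → T ≤ 1 → ν (Ioc 0 T) ≤ ENNReal.ofReal (C0 * T)) :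
    ∃ C : ℝ, 0 ≤ C ∧ ∀ r s t : ℝ, 0 ≤ r → r ≤ s → s ≤ t →
    ∫ ω, Xf μ r s (fun i => η i ω) ^ 2 * Xf μ s t (fun i => η i ω) ^ 2 ∂P ≤ C * (t - r)^2 := by
  obtain ⟨C, hC, hc⟩ := h.cnt4
  obtain ⟨D, hD, hd⟩ := h.cnt_sq
  obtain ⟨E, hE, he⟩ := h.cnt_prod hC0 hCν
  have hm := h.μpos
  refine ⟨C + 4 * E + 8 * μ^2 * D + 4 * μ^4, by positivity, fun r s t hr hrs hst => ?_⟩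
  have hpi : Measurable (fun ω (i : ℕ) => η i ω) := measurable_pi_lambda _ h.meas
  rcases le_total 1 (t - r) with hT | hT
  · have h4 := (int_of_lint ((h.meas_X r s).pow_const 4) (fun ω => by positivity) (by positivity)
      (hc (t - r) r s hT hr hrs (by linarith)))
    have h4' := (int_of_lint ((h.meas_X s t).pow_const 4) (fun ω => by positivity) (by positivity)
      (hc (t - r) s t hT (by linarith) hst (by linarith)))
    have p : ∀ ω, Xf μ r s (fun i => η i ω) ^ 2 * Xf μ s t (fun i => η i ω) ^ 2 ≤
      2⁻¹ * (Xf μ r s (fun i => η i ω) ^ 4 + Xf μ s t (fun i => η i ω) ^ 4) := by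
      intro ω
      nlinarith [sq_nonneg (Xf μ r s (fun i => η i ω) ^ 2 - Xf μ s t (fun i => η i ω) ^ 2)]
    have := integral_mono_of_nonneg (Eventually.of_forall fun ω => by
        simp only [Pi.zero_apply]; positivity)
      ((h4.1.add h4'.1).const_mul 2⁻¹) (Eventually.of_forall p)
    rw [integral_const_mul, integral_add' h4.1 h4'.1] at this
    have h5 : 0 ≤ (4 * E + 8 * μ^2 * D + 4 * μ^4) * (t-r)^2 := by positivity
    linarith [h4.2, h4'.2]
  · have he := he r s t hr hrs hst (by linarith)
    have hd1 := hd r s hr hrs (by linarith)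
    have hd2 := hd s t (by linarith) hst (by linarith)
    have m1 : Measurable (fun ω => cnt (fun i => η i ω) r s) := (measurable_cnt r s).comp hpi
    have m2 : Measurable (fun ω => cnt (fun i => η i ω) s t) := (measurable_cnt s t).comp hpi
    set T := t - r with hTd
    have hT0 : 0 ≤ T := by linarith
    have : ∫⁻ ω, ENNReal.ofReal (Xf μ r s (fun i => η i ω) ^ 2 * Xf μ s t (fun i => η i ω) ^ 2) ∂P
        ≤ ENNReal.ofReal ((C + 4 * E + 8 * μ^2 * D + 4 * μ^4) * T^2) := by
      have p : ∀ ω, ENNReal.ofReal (Xf μ r s (fun i => η i ω) ^ 2 * Xf μ s t (fun i => η i ω) ^ 2) ≤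
          ((ENNReal.ofReal 4 * (cnt (fun i => η i ω) r s ^ 2 * cnt (fun i => η i ω) s t ^ 2)
          + ENNReal.ofReal (4 * (μ * T)^2) * cnt (fun i => η i ω) r s ^ 2)
          + ENNReal.ofReal (4 * (μ * T)^2) * cnt (fun i => η i ω) s t ^ 2)
          + ENNReal.ofReal (4 * (μ * T)^4) := by
        intro ω
        unfold Xf
        set c := cnt (fun i => η i ω) r s
        set d := cnt (fun i => η i ω) s t
        have ee : ∀ c : ℝ≥0∞, ENNReal.ofReal (c.toReal ^ 2) ≤ c^2 := by
          intro c
          rw [ENNReal.ofReal_pow ENNReal.toReal_nonneg]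
          gcongr
          exact ENNReal.ofReal_toReal_le
        have e1 := ee c
        have e2 := ee d
        have e3 : ENNReal.ofReal (c.toReal ^ 2 * d.toReal ^ 2) ≤ c^2 * d^2 := by
          rw [ENNReal.ofReal_mul (by positivity)]
          exact mul_le_mul' e1 e2
        refine le_trans ?_ (add_le_add_left (add_le_add (add_le_add (mul_le_mul_right e3 _)
          (mul_le_mul_right e1 _)) (mul_le_mul_right e2 _)) _)
        rw [← ENNReal.ofReal_mul (by norm_num), ← ENNReal.ofReal_mul (by positivity),
          ← ENNReal.ofReal_mul (by positivity), ← ENNReal.ofReal_add (by positivity) (by positivity),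
          ← ENNReal.ofReal_add (by positivity) (by positivity),
          ← ENNReal.ofReal_add (by positivity) (by positivity)]
        refine ENNReal.ofReal_le_ofReal ?_
        have sqb : ∀ x a : ℝ, 0 ≤ a → a ≤ T → (x - μ * a)^2 ≤ 2 * x^2 + 2 * (μ*T)^2 := by
          intro x a ha haT
          have h1 : (μ * a)^2 ≤ (μ * T)^2 := pow_le_pow_left₀ (by positivity) (by gcongr) 2
          nlinarith [sq_nonneg (x + μ * a)]
        have := mul_le_mul (sqb c.toReal (s - r) (by linarith) (by linarith))
          (sqb d.toReal (t - s) (by linarith) (by linarith)) (by positivity) (by positivity)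
        refine this.trans (le_of_eq (by ring))
      refine (lintegral_mono p).trans ?_
      rw [lintegral_add_right _ measurable_const, lintegral_add_right _ (by fun_prop),
        lintegral_add_right _ (by fun_prop),
        lintegral_const_mul' _ _ ENNReal.ofReal_ne_top, lintegral_const_mul' _ _ ENNReal.ofReal_ne_top,
        lintegral_const_mul' _ _ ENNReal.ofReal_ne_top]
      simp only [lintegral_const, measure_univ, mul_one]
      have hd1' : ∫⁻ ω, cnt (fun i => η i ω) r s ^ 2 ∂P ≤ ENNReal.ofReal D :=
        hd1.trans (ENNReal.ofReal_le_ofReal (by nlinarith))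
      have hd2' : ∫⁻ ω, cnt (fun i => η i ω) s t ^ 2 ∂P ≤ ENNReal.ofReal D :=
        hd2.trans (ENNReal.ofReal_le_ofReal (by nlinarith))
      refine (add_le_add_left (add_le_add (add_le_add (mul_le_mul_right he _)
          (mul_le_mul_right hd1' _)) (mul_le_mul_right hd2' _)) _).trans ?_
      rw [← ENNReal.ofReal_mul (by norm_num), ← ENNReal.ofReal_mul (by positivity),
          ← ENNReal.ofReal_add (by positivity) (by positivity),
          ← ENNReal.ofReal_add (by positivity) (by positivity),
          ← ENNReal.ofReal_add (by positivity) (by positivity)]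
      refine ENNReal.ofReal_le_ofReal ?_
      have : (μ * T)^4 ≤ μ^4 * T^2 := by
        rw [mul_pow]
        refine mul_le_mul_of_nonneg_left ?_ (by positivity)
        exact pow_le_pow_of_le_one hT0 hT (by norm_num)
      nlinarith [mul_nonneg hC (sq_nonneg T)]
    exact (int_of_lint (((h.meas_X r s).pow_const 2).mul ((h.meas_X s t).pow_const 2)) (fun ω => mul_nonneg (sq_nonneg _) (sq_nonneg _))
      (by positivity) this).2

end
end RenAux

namespace RenAux
open scoped ENNReal NNReal
section
variable {Ω : Type*} [MeasurableSpace Ω] {P : Measure Ω} [IsProbabilityMeasure P]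

structure Good (P : Measure Ω) (A B : Ω → ℝ) : Prop where
  ma : Measurable A
  mb : Measurable B
  ia : Integrable (fun ω => A ω ^ 4) P
  ib : Integrable (fun ω => B ω ^ 4) P

lemma Good.mono {A B : Ω → ℝ} (h : Good P A B) (i j : ℕ) (hij : i + j ≤ 4) :
    Integrable (fun ω => A ω ^ i * B ω ^ j) P := by
  have := h.ma
  have := h.mb
  refine (((integrable_const (1:ℝ)).add h.ia).add h.ib).mono' (by fun_prop) ?_
  filter_upwards with ω
  simp only [Real.norm_eq_abs, Pi.add_apply, abs_mul, abs_pow]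
  set M := max 1 (max |A ω| |B ω|) with hM
  have hM1 : 1 ≤ M := le_max_left _ _
  have ha : |A ω| ≤ M := (le_max_left _ _).trans (le_max_right _ _)
  have hb : |B ω| ≤ M := (le_max_right _ _).trans (le_max_right _ _)
  have h1 : |A ω|^i * |B ω|^j ≤ M^i * M^j :=
    mul_le_mul (pow_le_pow_left₀ (abs_nonneg _) ha i) (pow_le_pow_left₀ (abs_nonneg _) hb j)
      (by positivity) (by positivity)
  have h2 : M^i * M^j ≤ M^4 := by
    rw [← pow_add]; exact pow_le_pow_right₀ hM1 hij
  have e1 : |A ω|^4 = A ω^4 := by rw [← abs_pow]; exact abs_of_nonneg (by positivity)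
  have e2 : |B ω|^4 = B ω^4 := by rw [← abs_pow]; exact abs_of_nonneg (by positivity)
  have h3 : M^4 ≤ 1 + A ω^4 + B ω^4 := by
    have p1 : 0 ≤ A ω^4 := by positivity
    have p2 : 0 ≤ B ω^4 := by positivity
    rcases max_choice 1 (max |A ω| |B ω|) with hc | hc
    · rw [hM, hc]; linarith
    · rw [hM, hc]
      rcases max_choice |A ω| |B ω| with hd | hd
      · rw [hd, e1]; linarith
      · rw [hd, e2]; linarith
  linarith

lemma pow4_add_int {A X : Ω → ℝ} (ma : Measurable A) (mx : Measurable X)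
    (ia : Integrable (fun ω => A ω ^ 4) P) (ix : Integrable (fun ω => X ω ^ 4) P) :
    Integrable (fun ω => (A ω + X ω)^4) P := by
  refine ((ia.const_mul 8).add (ix.const_mul 8)).mono' (by fun_prop) ?_
  filter_upwards with ω
  rw [Real.norm_eq_abs, abs_of_nonneg (by positivity)]
  exact four_add _ _

lemma Good.add {A B X Y : Ω → ℝ} (h : Good P A B) (g : Good P X Y) :
    Good P (fun ω => A ω + X ω) (fun ω => B ω + Y ω) :=
  ⟨h.ma.add g.ma, h.mb.add g.mb, pow4_add_int h.ma g.ma h.ia g.ia, pow4_add_int h.mb g.mb h.ib g.ib⟩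

lemma Good.ind {A B X Y : Ω → ℝ} (h : Good P A B) (g : Good P X Y)
    (hi : IndepFun (fun ω => (A ω, B ω)) (fun ω => (X ω, Y ω)) P)
    (i j k l : ℕ) (h1 : i + j ≤ 4) (h2 : k + l ≤ 4) :
    Integrable (fun ω => (A ω ^ i * B ω ^ j) * (X ω ^ k * Y ω ^ l)) P ∧
    ∫ ω, (A ω ^ i * B ω ^ j) * (X ω ^ k * Y ω ^ l) ∂P =
      (∫ ω, A ω ^ i * B ω ^ j ∂P) * ∫ ω, X ω ^ k * Y ω ^ l ∂P := by
  have hh := hi.comp (φ := fun q : ℝ × ℝ => q.1 ^ i * q.2 ^ j) (ψ := fun q : ℝ × ℝ => q.1 ^ k * q.2 ^ l)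
    (by fun_prop) (by fun_prop)
  refine ⟨IndepFun.integrable_mul hh (h.mono i j h1) (g.mono k l h2), ?_⟩
  exact hh.integral_fun_mul_eq_mul_integral (h.mono i j h1).aestronglyMeasurable (g.mono k l h2).aestronglyMeasurable

lemma iadd {f g : Ω → ℝ} (hf : Integrable f P) (hg : Integrable g P) :
    Integrable (fun ω => f ω + g ω) P := hf.add hg

lemma Good.step {A B X Y : Ω → ℝ} (h : Good P A B) (g : Good P X Y)
    (hi : IndepFun (fun ω => (A ω, B ω)) (fun ω => (X ω, Y ω)) P)
    (hA : ∫ ω, A ω ∂P = 0) (hB : ∫ ω, B ω ∂P = 0) (hX : ∫ ω, X ω ∂P = 0) (hY : ∫ ω, Y ω ∂P = 0) :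
    ∫ ω, (A ω + X ω)^2 ∂P = ∫ ω, A ω ^2 ∂P + ∫ ω, X ω ^2 ∂P ∧
    ∫ ω, (B ω + Y ω)^2 ∂P = ∫ ω, B ω ^2 ∂P + ∫ ω, Y ω ^2 ∂P ∧
    ∫ ω, (A ω + X ω)^2 * (B ω + Y ω)^2 ∂P = ∫ ω, A ω ^2 * B ω^2 ∂P
      + (∫ ω, A ω ^2 ∂P) * (∫ ω, Y ω ^2 ∂P) + (∫ ω, B ω ^2 ∂P) * (∫ ω, X ω ^2 ∂P)
      + 4 * ((∫ ω, A ω * B ω ∂P) * (∫ ω, X ω * Y ω ∂P)) + ∫ ω, X ω ^2 * Y ω^2 ∂P := by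
  have I := fun i j k l h1 h2 => (h.ind g hi i j k l h1 h2).1
  have E := fun i j k l h1 h2 => (h.ind g hi i j k l h1 h2).2
  refine ⟨?_, ?_, ?_⟩
  · have e : ∀ ω, (A ω + X ω)^2 = A ω ^2 + (2 * ((A ω ^ 1 * B ω ^ 0) * (X ω ^ 1 * Y ω ^ 0)) + X ω^2) := by
      intro ω; ring
    simp_rw [e]
    have a1 : Integrable (fun ω => A ω ^ 2) P := by simpa using h.mono 2 0 (by norm_num)
    have a2 : Integrable (fun ω => X ω ^ 2) P := by simpa using g.mono 2 0 (by norm_num)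
    have a3 := (I 1 0 1 0 (by norm_num) (by norm_num)).const_mul 2
    rw [integral_add a1 (iadd a3 a2), integral_add a3 a2, integral_const_mul, E 1 0 1 0 (by norm_num) (by norm_num)]
    simp [hA]
  · have e : ∀ ω, (B ω + Y ω)^2 = B ω ^2 + (2 * ((A ω ^ 0 * B ω ^ 1) * (X ω ^ 0 * Y ω ^ 1)) + Y ω^2) := by
      intro ω; ring
    simp_rw [e]
    have a1 : Integrable (fun ω => B ω ^ 2) P := by simpa using h.mono 0 2 (by norm_num)
    have a2 : Integrable (fun ω => Y ω ^ 2) P := by simpa using g.mono 0 2 (by norm_num)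
    have a3 := (I 0 1 0 1 (by norm_num) (by norm_num)).const_mul 2
    rw [integral_add a1 (iadd a3 a2), integral_add a3 a2, integral_const_mul, E 0 1 0 1 (by norm_num) (by norm_num)]
    simp [hB]
  · have e : ∀ ω, (A ω + X ω)^2 * (B ω + Y ω)^2 = A ω ^2 * B ω ^2
      + (2 * ((A ω ^ 2 * B ω ^ 1) * (X ω ^ 0 * Y ω ^ 1))
      + (((A ω ^ 2 * B ω ^ 0) * (X ω ^ 0 * Y ω ^ 2))
      + (2 * ((A ω ^ 1 * B ω ^ 2) * (X ω ^ 1 * Y ω ^ 0))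
      + (4 * ((A ω ^ 1 * B ω ^ 1) * (X ω ^ 1 * Y ω ^ 1))
      + (2 * ((A ω ^ 1 * B ω ^ 0) * (X ω ^ 1 * Y ω ^ 2))
      + (((A ω ^ 0 * B ω ^ 2) * (X ω ^ 2 * Y ω ^ 0))
      + (2 * ((A ω ^ 0 * B ω ^ 1) * (X ω ^ 2 * Y ω ^ 1))
      + X ω ^2 * Y ω ^2))))))) := by
      intro ω; ring
    simp_rw [e]
    have a0 := h.mono 2 2 (by norm_num)
    have a1 := (I 2 1 0 1 (by norm_num) (by norm_num)).const_mul 2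
    have a2 := (I 2 0 0 2 (by norm_num) (by norm_num))
    have a3 := (I 1 2 1 0 (by norm_num) (by norm_num)).const_mul 2
    have a4 := (I 1 1 1 1 (by norm_num) (by norm_num)).const_mul 4
    have a5 := (I 1 0 1 2 (by norm_num) (by norm_num)).const_mul 2
    have a6 := (I 0 2 2 0 (by norm_num) (by norm_num))
    have a7 := (I 0 1 2 1 (by norm_num) (by norm_num)).const_mul 2
    have a8 := g.mono 2 2 (by norm_num)
    have b7 := iadd a7 a8
    have b6 := iadd a6 b7
    have b5 := iadd a5 b6
    have b4 := iadd a4 b5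
    have b3 := iadd a3 b4
    have b2 := iadd a2 b3
    have b1 := iadd a1 b2
    rw [integral_add a0 b1, integral_add a1 b2, integral_add a2 b3, integral_add a3 b4,
      integral_add a4 b5, integral_add a5 b6, integral_add a6 b7, integral_add a7 a8]
    simp only [integral_const_mul]
    rw [E 2 1 0 1 (by norm_num) (by norm_num), E 2 0 0 2 (by norm_num) (by norm_num),
      E 1 2 1 0 (by norm_num) (by norm_num), E 1 1 1 1 (by norm_num) (by norm_num),
      E 1 0 1 2 (by norm_num) (by norm_num), E 0 2 2 0 (by norm_num) (by norm_num),
      E 0 1 2 1 (by norm_num) (by norm_num)]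
    simp only [pow_zero, pow_one, one_mul, mul_one, hA, hB, hX, hY, mul_zero, zero_mul, zero_add]
    ring

lemma Good.ab {A B : Ω → ℝ} (h : Good P A B) {c : ℝ} (h1 : ∫ ω, A ω ^2 ∂P ≤ c) (h2 : ∫ ω, B ω ^2 ∂P ≤ c) :
    |∫ ω, A ω * B ω ∂P| ≤ c := by
  have a1 : Integrable (fun ω => A ω ^ 2) P := by simpa using h.mono 2 0 (by norm_num)
  have a2 : Integrable (fun ω => B ω ^ 2) P := by simpa using h.mono 0 2 (by norm_num)
  have : ∫ ω, |A ω * B ω| ∂P ≤ ∫ ω, 2⁻¹ * (A ω^2 + B ω^2) ∂P := by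
    refine integral_mono_of_nonneg (Eventually.of_forall fun ω => abs_nonneg _) ((a1.add a2).const_mul _)
      (Eventually.of_forall fun ω => ?_)
    simp only [abs_mul]
    nlinarith [sq_nonneg (|A ω| - |B ω|), sq_abs (A ω), sq_abs (B ω)]
  rw [integral_const_mul, integral_add a1 a2] at this
  exact abs_integral_le_integral_abs.trans (by linarith)

lemma superpos {X Y : ℕ → Ω → ℝ} (hg : ∀ j, Good P (X j) (Y j))
    (hi : ∀ n, IndepFun (fun ω => (∑ j ∈ Finset.range n, X j ω, ∑ j ∈ Finset.range n, Y j ω))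
      (fun ω => (X n ω, Y n ω)) P)
    (hX : ∀ j, ∫ ω, X j ω ∂P = 0) (hY : ∀ j, ∫ ω, Y j ω ∂P = 0) {a b : ℝ}
    (hX2 : ∀ j, ∫ ω, X j ω ^ 2 ∂P ≤ a) (hY2 : ∀ j, ∫ ω, Y j ω ^ 2 ∂P ≤ a)
    (hXY : ∀ j, ∫ ω, X j ω ^ 2 * Y j ω ^ 2 ∂P ≤ b) (n : ℕ) :
    Good P (fun ω => ∑ j ∈ Finset.range n, X j ω) (fun ω => ∑ j ∈ Finset.range n, Y j ω) ∧
    ∫ ω, ∑ j ∈ Finset.range n, X j ω ∂P = 0 ∧ ∫ ω, ∑ j ∈ Finset.range n, Y j ω ∂P = 0 ∧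
    ∫ ω, (∑ j ∈ Finset.range n, X j ω)^2 ∂P ≤ n * a ∧
    ∫ ω, (∑ j ∈ Finset.range n, Y j ω)^2 ∂P ≤ n * a ∧
    ∫ ω, (∑ j ∈ Finset.range n, X j ω)^2 * (∑ j ∈ Finset.range n, Y j ω)^2 ∂P ≤ 3 * n^2 * a^2 + n * b := by
  induction n with
  | zero =>
    simp
    exact ⟨measurable_const, measurable_const, by simp, by simp⟩
  | succ n ih =>
    obtain ⟨g, m1, m2, s1, s2, s3⟩ := ih
    simp_rw [Finset.sum_range_succ]
    obtain ⟨t1, t2, t3⟩ := g.step (hg n) (hi n) m1 m2 (hX n) (hY n)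
    have i1 : Integrable (fun ω => ∑ j ∈ Finset.range n, X j ω) P := by simpa using g.mono 1 0 (by norm_num)
    have i2 : Integrable (fun ω => ∑ j ∈ Finset.range n, Y j ω) P := by simpa using g.mono 0 1 (by norm_num)
    have i3 : Integrable (X n) P := by simpa using (hg n).mono 1 0 (by norm_num)
    have i4 : Integrable (Y n) P := by simpa using (hg n).mono 0 1 (by norm_num)
    have c1 := g.ab s1 s2
    have c2 := (hg n).ab (hX2 n) (hY2 n)
    have na : 0 ≤ (n:ℝ) * a := (abs_nonneg _).trans c1
    have a0 : 0 ≤ a := (abs_nonneg _).trans c2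
    refine ⟨g.add (hg n), ?_, ?_, ?_, ?_, ?_⟩
    · rw [integral_add i1 i3, m1, hX n, add_zero]
    · rw [integral_add i2 i4, m2, hY n, add_zero]
    · rw [t1]; push_cast; linarith [hX2 n]
    · rw [t2]; push_cast; linarith [hY2 n]
    · rw [t3]
      have d1 := mul_le_mul s1 (hY2 n) (integral_nonneg fun ω => sq_nonneg _) na
      have d2 := mul_le_mul s2 (hX2 n) (integral_nonneg fun ω => sq_nonneg _) na
      have d3 : (∫ ω, (∑ j ∈ Finset.range n, X j ω) * (∑ j ∈ Finset.range n, Y j ω) ∂P) * (∫ ω, X n ω * Y n ω ∂P)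
        ≤ n * a * a := by
        refine (le_abs_self _).trans ?_
        rw [abs_mul]
        exact mul_le_mul c1 c2 (abs_nonneg _) na
      push_cast
      nlinarith [hXY n, sq_nonneg a]

end
end RenAux

namespace RenAux
open scoped ENNReal NNReal
section
variable {Ω : Type*} [MeasurableSpace Ω] {P : Measure Ω} [IsProbabilityMeasure P]
  {ν : Measure ℝ} [IsProbabilityMeasure ν] {μ : ℝ}

lemma sSup_cnt {x : ℕ → ℝ} (hx : Monotone (ps x)) (hd : ∀ s : ℝ, ∃ m, s < ps x (m+1)) {r s : ℝ}
    (hr : 0 ≤ r) (hrs : r ≤ s) :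
    ((sSup {k : ℕ | ps x k ≤ s} : ℕ) : ℝ) - ((sSup {k : ℕ | ps x k ≤ r} : ℕ) : ℝ) = (cnt x r s).toReal := by
  have key : ∀ t : ℝ, 0 ≤ t → ∀ k, k ≤ sSup {k : ℕ | ps x k ≤ t} ↔ ps x k ≤ t := by
    intro t ht k
    have hb : BddAbove {k : ℕ | ps x k ≤ t} := by
      obtain ⟨m, hm⟩ := hd t
      refine ⟨m+1, fun k hk => ?_⟩
      by_contra hc
      have := hx (le_of_lt (not_le.1 hc))
      have hk' : ps x k ≤ t := hk
      linarith
    have hne : {k : ℕ | ps x k ≤ t}.Nonempty := ⟨0, by simpa [ps] using ht⟩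
    have hmem := Nat.sSup_mem hne hb
    refine ⟨fun h => (hx h).trans hmem, fun h => le_csSup hb h⟩
  obtain ⟨J, hJ, hc⟩ := cnt_finset hx hd r s
  have e : J = Finset.Ico (sSup {k : ℕ | ps x k ≤ r}) (sSup {k : ℕ | ps x k ≤ s}) := by
    ext k
    have h1 := key r hr (k+1)
    have h2 := key s (hr.trans hrs) (k+1)
    rw [hJ, Finset.mem_Ico, mem_Ioc, ← h2, ← not_le, ← h1]
    omega
  have hle : sSup {k : ℕ | ps x k ≤ r} ≤ sSup {k : ℕ | ps x k ≤ s} :=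
    (key s (hr.trans hrs) _).2 (((key r hr _).1 le_rfl).trans hrs)
  rw [hc, e]
  rw [ENNReal.toReal_natCast, Nat.card_Ico, Nat.cast_sub hle]

lemma C1_bound {F : ℝ → ℝ} (hF : ∀ t, F t = (ν (Set.Iic t)).toReal)
    (hC1 : ∃ C : ℝ, ∀ᶠ t in nhdsWithin (0:ℝ) (Set.Ioi 0), (F t - F 0) / t ≤ C) :
    ∃ C0 : ℝ, 0 ≤ C0 ∧ ∀ T, 0 < T → T ≤ 1 → ν (Ioc 0 T) ≤ ENNReal.ofReal (C0*T) := by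
  obtain ⟨C, hC⟩ := hC1
  rw [eventually_nhdsWithin_iff, Metric.eventually_nhds_iff] at hC
  obtain ⟨δ, hδ, h⟩ := hC
  have hp : 0 < 1/δ := by positivity
  refine ⟨max C 0 + 1/δ, by positivity, fun T hT hT1 => ?_⟩
  have e : (max C 0 + 1/δ) * T = max C 0 * T + T/δ := by ring
  by_cases hc : T < δ
  · have h1 := h (y := T) (by simpa [abs_of_pos hT] using hc) hT
    rw [div_le_iff₀ hT] at h1
    have h2 : ν (Ioc 0 T) = ENNReal.ofReal (F T - F 0) := by
      rw [show Ioc 0 T = Iic T \ Iic 0 by ext x; simp [and_comm], measure_diff (Iic_subset_Iic.2 hT.le) measurableSet_Iic.nullMeasurableSet (measure_ne_top _ _), hF, hF,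
        ENNReal.ofReal_sub _ ENNReal.toReal_nonneg, ENNReal.ofReal_toReal (measure_ne_top _ _),
        ENNReal.ofReal_toReal (measure_ne_top _ _)]
    rw [h2]
    refine ENNReal.ofReal_le_ofReal ?_
    have := mul_le_mul_of_nonneg_right (le_max_left C 0) hT.le
    have : 0 ≤ T/δ := by positivity
    rw [e]; linarith
  · refine prob_le_one.trans ?_
    rw [ENNReal.one_le_ofReal, e]
    have : 1 ≤ T/δ := by rw [le_div_iff₀ hδ]; linarith
    have : 0 ≤ max C 0 * T := by positivity
    linarith

lemma Ren.map_eq {η η' : ℕ → Ω → ℝ} (h : Ren P ν μ η) (h' : Ren P ν μ η') :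
    P.map (fun ω i => η i ω) = P.map (fun ω i => η' i ω) := by
  rw [h.indep.map_fun_eq_infinitePi_map h.meas, h'.indep.map_fun_eq_infinitePi_map h'.meas]
  have : (fun i => P.map (η i)) = fun i => P.map (η' i) := by
    funext i
    cases i with
    | zero => rw [h.law0, h'.law0]
    | succ k => rw [h.law, h'.law]
  rw [this]

lemma Ren.int_eq {η η' : ℕ → Ω → ℝ} (h : Ren P ν μ η) (h' : Ren P ν μ η') {f : (ℕ → ℝ) → ℝ}
    (hf : Measurable f) : ∫ ω, f (fun i => η i ω) ∂P = ∫ ω, f (fun i => η' i ω) ∂P := by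
  have m1 : Measurable (fun ω i => η i ω) := measurable_pi_lambda _ h.meas
  have m2 : Measurable (fun ω i => η' i ω) := measurable_pi_lambda _ h'.meas
  rw [← integral_map (φ := fun ω i => η i ω) m1.aemeasurable hf.aestronglyMeasurable, h.map_eq h',
    integral_map m2.aemeasurable hf.aestronglyMeasurable]

lemma mk_Ren (hμ : 0 < μ) (hsupp : ν (Set.Iio 0) = 0)
    (hmean : ∫ x, x ∂ν = 1 / μ) 
    (F : ℝ → ℝ) (hF : ∀ t, F t = (ν (Set.Iic t)).toReal)
    (hC2 : Integrable (fun x => x ^ 3) ν)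
    (νe : Measure ℝ)
    (hνe : νe = MeasureTheory.volume.withDensity fun t =>
      ENNReal.ofReal (Set.indicator (Set.Ici 0) (fun u => μ * (1 - F u)) t))
    (ξ : ℕ → ℕ → Ω → ℝ)
    (hmeas : ∀ j k, Measurable (ξ j k))
    (hnonneg : ∀ j k ω, 0 ≤ ξ j k ω)
    (hindep : iIndepFun (m := fun _ : ℕ × ℕ => (inferInstance : MeasurableSpace ℝ))
      (fun p : ℕ × ℕ => ξ p.1 (p.2 + 1)) P)
    (hdist1 : ∀ j, Measure.map (ξ j 1) P = νe)
    (hdist : ∀ j k, 2 ≤ k → Measure.map (ξ j k) P = ν) (j : ℕ) :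
    Ren P ν μ (fun k => ξ j (k+1)) where
  meas k := hmeas _ _
  nonneg k ω := hnonneg _ _ _
  indep := hindep.precomp (g := fun k : ℕ => (j, k)) (fun a b hab => by simpa using hab)
  law0 := by
    simp only [zero_add]
    rw [hdist1, hνe]
    congr 1
    funext t
    by_cases ht : t ∈ Ici (0:ℝ)
    · rw [indicator_of_mem ht, indicator_of_mem ht, ENNReal.ofReal_mul hμ.le]
      congr 1
      rw [hF, ENNReal.ofReal_sub _ ENNReal.toReal_nonneg, ENNReal.ofReal_toReal (measure_ne_top _ _), ENNReal.ofReal_one,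
        ← compl_Iic, prob_compl_eq_one_sub measurableSet_Iic]
    · rw [indicator_of_notMem ht, indicator_of_notMem ht]; simp
  law k := hdist _ _ (by omega)
  μpos := hμ
  supp := by
    rw [ae_iff]; convert hsupp using 2; ext x; simp
  mean := hmean
  int3 := hC2

end
end RenAux

open RenAux in
theorem fourth_aux
    {Ω : Type*} [MeasurableSpace Ω] (P : Measure Ω) [IsProbabilityMeasure P]
    (μ : ℝ) (ν : Measure ℝ) [IsProbabilityMeasure ν]
    {C0 : ℝ} (hC0 : 0 ≤ C0) (hCν : ∀ T, 0 < T → T ≤ 1 → ν (Ioc 0 T) ≤ ENNReal.ofReal (C0*T))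
    (ξ : ℕ → ℕ → Ω → ℝ)
    (hmeas : ∀ j k, Measurable (ξ j k))
    (hindep : iIndepFun (m := fun _ : ℕ × ℕ => (inferInstance : MeasurableSpace ℝ))
      (fun p : ℕ × ℕ => ξ p.1 (p.2 + 1)) P)
    (hR : ∀ j, Ren P ν μ (fun k => ξ j (k+1))) :
    ∃ C1 C2 : ℝ, 0 ≤ C1 ∧ 0 ≤ C2 ∧ ∀ (n : ℕ) (r s t : ℝ), 0 ≤ r → r ≤ s → s ≤ t →
      ∫ ω, (∑ j ∈ Finset.range n, Xf μ r s (fun i => ξ j (i+1) ω))^2 *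
        (∑ j ∈ Finset.range n, Xf μ s t (fun i => ξ j (i+1) ω))^2 ∂P ≤
        3 * n^2 * (C1 * (t-r))^2 + n * (C2 * (t-r)^2) := by
  obtain ⟨C1, hC1, h1⟩ := (hR 0).X2
  obtain ⟨C2, hC2, h2⟩ := (hR 0).X2Y2 hC0 hCν
  refine ⟨C1, C2, hC1, hC2, fun n r s t hr hrs hst => ?_⟩
  have hs : 0 ≤ s := hr.trans hrs
  have mX := measurable_Xf μ r s
  have mY := measurable_Xf μ s t
  refine (superpos (P := P) (X := fun j ω => Xf μ r s (fun i => ξ j (i+1) ω))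
    (Y := fun j ω => Xf μ s t (fun i => ξ j (i+1) ω)) ?_ ?_ ?_ ?_ (a := C1 * (t-r)) (b := C2 * (t-r)^2)
    ?_ ?_ ?_ n).2.2.2.2.2
  · exact fun j => ⟨(hR j).meas_X r s, (hR j).meas_X s t, (hR j).X4 hr hrs, (hR j).X4 hs hst⟩
  · intro n
    have mp : ∀ j : ℕ, Measurable (fun (x : ℕ × ℕ → ℝ) (i : ℕ) => x (j, i)) := fun j => by fun_prop
    exact indep_dep (ι := ℕ × ℕ) hindep (fun p => hmeas _ _) (S := {p | p.1 < n}) (T := {p | p.1 = n})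
      (Set.disjoint_left.2 fun p hp hq => by
        simp only [mem_ofPred_eq] at hp hq; omega)
      (f := fun x => (∑ j ∈ Finset.range n, Xf μ r s (fun i => x (j,i)), ∑ j ∈ Finset.range n, Xf μ s t (fun i => x (j,i))))
      (g := fun x => (Xf μ r s (fun i => x (n,i)), Xf μ s t (fun i => x (n,i))))
      ((Finset.measurable_sum _ fun j _ => mX.comp (mp j)).prodMk
        (Finset.measurable_sum _ fun j _ => mY.comp (mp j)))
      ((mX.comp (mp n)).prodMk (mY.comp (mp n)))
      (fun x y hxy => by
        have e : ∀ j ∈ Finset.range n, (fun i => x (j,i)) = fun i => y (j,i) := fun j hj => by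
          funext i; exact hxy (j,i) (Finset.mem_range.1 hj)
        simp only [Prod.mk.injEq]
        exact ⟨Finset.sum_congr rfl fun j hj => by rw [e j hj], Finset.sum_congr rfl fun j hj => by rw [e j hj]⟩)
      (fun x y hxy => by
        have e : (fun i => x (n,i)) = fun i => y (n,i) := by
          funext i; exact hxy (n,i) rfl
        simp only [e])
  · exact fun j => (hR j).X_mean hr hrs
  · exact fun j => (hR j).X_mean hs hst
  · intro j
    have := (hR j).int_eq (hR 0) (f := fun x => Xf μ r s x ^ 2) (mX.pow_const 2)
    refine this.trans_le ((h1 r s hr hrs).trans ?_)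
    exact mul_le_mul_of_nonneg_left (by linarith) hC1
  · intro j
    have := (hR j).int_eq (hR 0) (f := fun x => Xf μ s t x ^ 2) (mY.pow_const 2)
    refine this.trans_le ((h1 s t hs hst).trans ?_)
    exact mul_le_mul_of_nonneg_left (by linarith) hC1
  · intro j
    have := (hR j).int_eq (hR 0) (f := fun x => Xf μ r s x ^ 2 * Xf μ s t x ^ 2) ((mX.pow_const 2).mul (mY.pow_const 2))
    exact this.trans_le (h2 r s t hr hrs hst)

/-- Fourth-moment bound for the increments of the diffusion-scaled superposition
`B̃ₙ(t) = (n γₙ)^{-1/2} (Bₙ(γₙ t) - n μ γₙ t)` of stationary renewal processes: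
there is a constant `c ∈ (0, ∞)` such that for all `0 ≤ r ≤ s ≤ t` and all `n ≥ 1`,
`E[(B̃ₙ(s) - B̃ₙ(r))² (B̃ₙ(t) - B̃ₙ(s))²] ≤ c (t - r)²`. -/
theorem fourth_moment_bound_superposition_renewal
    {Ω : Type*} [MeasurableSpace Ω] (P : Measure Ω) [IsProbabilityMeasure P]
    (μ : ℝ) (hμ : 0 < μ)
    (ν : Measure ℝ) [IsProbabilityMeasure ν] (hsupp : ν (Set.Iio 0) = 0)
    (hmean : ∫ x, x ∂ν = 1 / μ) (hsq : Integrable (fun x => x ^ 2) ν)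
    (F : ℝ → ℝ) (hF : ∀ t, F t = (ν (Set.Iic t)).toReal)
    -- condition (C1): `limsup_{t ↓ 0} t⁻¹ (F t - F 0) < ∞`
    (hC1 : ∃ C : ℝ, ∀ᶠ t in nhdsWithin (0:ℝ) (Set.Ioi 0), (F t - F 0) / t ≤ C)
    -- condition (C2): finite third moment
    (hC2 : Integrable (fun x => x ^ 3) ν)
    (νe : Measure ℝ)
    (hνe : νe = MeasureTheory.volume.withDensity fun t =>
      ENNReal.ofReal (Set.indicator (Set.Ici 0) (fun u => μ * (1 - F u)) t))
    (ξ : ℕ → ℕ → Ω → ℝ)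
    (hmeas : ∀ j k, Measurable (ξ j k))
    (hnonneg : ∀ j k ω, 0 ≤ ξ j k ω)
    (hindep : iIndepFun (m := fun _ : ℕ × ℕ => (inferInstance : MeasurableSpace ℝ))
      (fun p : ℕ × ℕ => ξ p.1 (p.2 + 1)) P)
    (hdist1 : ∀ j, Measure.map (ξ j 1) P = νe)
    (hdist : ∀ j k, 2 ≤ k → Measure.map (ξ j k) P = ν)
    (S : ℕ → ℕ → Ω → ℝ)
    (hS : ∀ j k ω, S j k ω = ∑ i ∈ Finset.range k, ξ j (i + 1) ω)
    (N : ℕ → ℝ → Ω → ℕ)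
    (hN : ∀ j t ω, N j t ω = sSup {k : ℕ | S j k ω ≤ t})
    (γ : ℕ → ℝ) (hγpos : ∀ n, 0 < γ n) (hγ : Tendsto γ atTop atTop)
    -- the diffusion-scaled superposition process
    (Bt : ℕ → ℝ → Ω → ℝ)
    (hBt : ∀ n t ω, Bt n t ω = (Real.sqrt ((n : ℝ) * γ n))⁻¹ *
      ((∑ j ∈ Finset.range n, (N j (γ n * t) ω : ℝ)) - (n : ℝ) * μ * γ n * t)) :
    ∃ c : ℝ, 0 < c ∧ ∀ n : ℕ, 1 ≤ n → ∀ r s t : ℝ, 0 ≤ r → r ≤ s → s ≤ t →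
      (∫ ω, (Bt n s ω - Bt n r ω) ^ 2 * (Bt n t ω - Bt n s ω) ^ 2 ∂P)
        ≤ c * (t - r) ^ 2 := by
  obtain ⟨C0, hC0, hCν⟩ := RenAux.C1_bound (ν := ν) hF hC1
  have hR := RenAux.mk_Ren (P := P) hμ hsupp hmean F hF hC2 νe hνe ξ hmeas hnonneg hindep hdist1 hdist
  obtain ⟨C1, C2, h1, h2, H⟩ := fourth_aux P μ ν hC0 hCν ξ hmeas hindep hR
  refine ⟨3 * C1^2 + C2 + 1, by positivity, fun n hn r s t hr hrs hst => ?_⟩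
  have hn' : (1:ℝ) ≤ n := by exact_mod_cast hn
  have hg := hγpos n
  set g := γ n with hgdef
  have hng : 0 < (n:ℝ) * g := by positivity
  have hae : ∀ᵐ ω ∂P, ∀ j, ∀ s : ℝ, ∃ m, s < RenAux.ps (fun i => ξ j (i+1) ω) (m+1) :=
    ae_all_iff.2 fun j => (hR j).diverge'
  have key : ∀ᵐ ω ∂P, ∀ a b : ℝ, 0 ≤ a → a ≤ b → Bt n b ω - Bt n a ω =
      (Real.sqrt ((n : ℝ) * g))⁻¹ * ∑ j ∈ Finset.range n, RenAux.Xf μ (g*a) (g*b) (fun i => ξ j (i+1) ω) := by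
    filter_upwards [hae] with ω hω a b ha hab
    rw [hBt, hBt, ← mul_sub]
    congr 1
    have e : ∀ j, RenAux.Xf μ (g*a) (g*b) (fun i => ξ j (i+1) ω) =
        (N j (g*b) ω : ℝ) - N j (g*a) ω - μ * (g * b - g * a) := by
      intro j
      have := RenAux.sSup_cnt ((hR j).ps_mono ω) (hω j) (r := g*a) (s := g*b) (by positivity)
        (mul_le_mul_of_nonneg_left hab hg.le)
      rw [RenAux.Xf, ← this, hN, hN]
      simp only [hS]
      rfl
    simp_rw [e]
    rw [Finset.sum_sub_distrib, Finset.sum_sub_distrib, Finset.sum_const, Finset.card_range, nsmul_eq_mul]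
    ring
  have hsqrt : (Real.sqrt ((n : ℝ) * g))⁻¹ ^ 2 = ((n:ℝ) * g)⁻¹ := by
    rw [inv_pow, Real.sq_sqrt hng.le]
  have hcongr : (∫ ω, (Bt n s ω - Bt n r ω) ^ 2 * (Bt n t ω - Bt n s ω) ^ 2 ∂P) =
      ∫ ω, (((n:ℝ) * g)⁻¹)^2 * ((∑ j ∈ Finset.range n, RenAux.Xf μ (g*r) (g*s) (fun i => ξ j (i+1) ω))^2 *
        (∑ j ∈ Finset.range n, RenAux.Xf μ (g*s) (g*t) (fun i => ξ j (i+1) ω))^2) ∂P := by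
    refine integral_congr_ae ?_
    filter_upwards [key] with ω hω
    rw [hω r s hr hrs, hω s t (hr.trans hrs) hst, mul_pow, mul_pow, hsqrt]
    ring
  rw [hcongr, integral_const_mul]
  have := H n (g*r) (g*s) (g*t) (by positivity) (mul_le_mul_of_nonneg_left hrs hg.le)
    (mul_le_mul_of_nonneg_left hst hg.le)
  refine (mul_le_mul_of_nonneg_left this (by positivity)).trans ?_
  rw [inv_pow, inv_mul_le_iff₀ (by positivity)]
  have hq : 0 ≤ (g * (t - r))^2 := by positivity
  have hnn : (n:ℝ) ≤ n^2 := by nlinarith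
  have e1 : 3 * (n:ℝ)^2 * (C1 * (g * t - g * r))^2 = 3 * C1^2 * (n:ℝ)^2 * (g * (t - r))^2 := by ring
  have e2 : (n:ℝ) * (C2 * (g * t - g * r)^2) = (n:ℝ) * (C2 * (g * (t - r))^2) := by ring
  have e3 : ((n:ℝ) * g)^2 * ((3 * C1^2 + C2 + 1) * (t - r)^2) =
      3 * C1^2 * (n:ℝ)^2 * (g * (t - r))^2 + (n:ℝ)^2 * (C2 * (g * (t - r))^2) + (n:ℝ)^2 * (g * (t - r))^2 := by ring
  have h4 := mul_le_mul_of_nonneg_right hnn (mul_nonneg h2 hq)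
  have h5 : 0 ≤ (n:ℝ)^2 * (g * (t - r))^2 := by positivity
  rw [e1, e2, e3]
  linarith
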